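/- Let f:(ℝ³,0)→(ℝ⁴,0) be a frontal with normal vector ν, identifier of singularities λ and null vector field η, with ηλ(0)≠0 (so 0 is a non-degenerate singular point). Let (ξ₁,ξ₂,η) be an adapted triple of vector fields, i.e. ξ₁,ξ₂ are linearly independent and tangent to S(f) and η is a null vector field, and set ψ̄=det(ξ₁f, ξ₂f, ν, ην). Then f is a cuspidal cross cap × interval (A-equivalent to (t,s,r)↦(t,s,r²,sr³)) if and only if ψ̄(0)=0 and (ξ₁ψ̄(0),ξ₂ψ̄(0))≠(0,0). -/

import Mathlib

open scoped Topology
open Filter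

noncomputable section

/-- Ambient space `ℝ⁴`. -/
abbrev E4 := Fin 4 → ℝ

/-- The standard inner product on `ℝ⁴`. -/
def dot4 (u v : E4) : ℝ := ∑ i, u i * v i

/-- `det(u,v,w,x)` for four vectors of `ℝ⁴`. -/
def det4 (u v w x : E4) : ℝ := Matrix.det (Matrix.of ![u, v, w, x])

/-- A diffeomorphism-germ at `p`: smooth at `p` with invertible differential. -/
def IsDiffeoGermAt {E : Type*} [NormedAddCommGroup E] [NormedSpace ℝ E]
    (φ : E → E) (p : E) : Prop :=
  ContDiffAt ℝ (⊤ : ℕ∞) φ p ∧ Function.Bijective (fderiv ℝ φ p)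

/-- `f` at `p` is 𝒜-equivalent to the germ of `g` at `0`. -/
def AEquivAt (f : ℝ × ℝ × ℝ → E4) (p : ℝ × ℝ × ℝ) (g : ℝ × ℝ × ℝ → E4) : Prop :=
  ∃ (φ : ℝ × ℝ × ℝ → ℝ × ℝ × ℝ) (Φ : E4 → E4),
    IsDiffeoGermAt φ p ∧ IsDiffeoGermAt Φ (f p) ∧
    φ p = 0 ∧ Φ (f p) = g 0 ∧ ∀ᶠ q in 𝓝 p, Φ (f q) = g (φ q)

section
open scoped Topology ContDiff
open Filter MeasureTheory

theorem HTG_fderiv {E F : Type*} [NormedAddCommGroup E] [NormedSpace ℝ E]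
    [NormedAddCommGroup F] [NormedSpace ℝ F] {K : E → F} (hK : K.HasTemperateGrowth) :
    (fderiv ℝ K).HasTemperateGrowth := by
  refine ⟨hK.1.fderiv_right (m := ∞) (by simp), fun n => ?_⟩
  obtain ⟨k, C, h⟩ := hK.2 (n+1)
  refine ⟨k, C, fun x => ?_⟩
  rw [norm_iteratedFDeriv_fderiv]
  exact h x

theorem PI_bound {V W G : Type} [NormedAddCommGroup V] [NormedSpace ℝ V]
    [NormedAddCommGroup W] [NormedSpace ℝ W] [NormedAddCommGroup G] [NormedSpace ℝ G]
    {K : W × V → G} (hK : K.HasTemperateGrowth) :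
    ∃ (k : ℕ) (C : ℝ), 0 ≤ C ∧ ∀ w x, ‖K (w,x)‖ ≤ C * (1 + ‖x‖)^k * (1 + ‖w‖)^k := by
  obtain ⟨k, C, hC, h⟩ := hK.norm_iteratedFDeriv_le_uniform 0
  refine ⟨k, C, hC, fun w x => ?_⟩
  have h1 := h 0 le_rfl (w,x)
  rw [norm_iteratedFDeriv_zero] at h1
  refine h1.trans ?_
  rw [mul_assoc, ← mul_pow]
  gcongr
  have : ‖(w,x)‖ ≤ ‖w‖ + ‖x‖ := by
    rw [Prod.norm_def]; simp only [sup_le_iff]; constructor <;> linarith [norm_nonneg w, norm_nonneg x]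
  nlinarith [norm_nonneg w, norm_nonneg x]

theorem PI {V W : Type} [NormedAddCommGroup V] [NormedSpace ℝ V] [FiniteDimensional ℝ V]
    [NormedAddCommGroup W] [NormedSpace ℝ W] [FiniteDimensional ℝ W] [MeasurableSpace W]
    [BorelSpace W] (μ : Measure W) (F : W → ℝ) (hFm : AEStronglyMeasurable F μ)
    (hF : ∀ k : ℕ, Integrable (fun w => (1 + ‖w‖)^k * ‖F w‖) μ) :
    ∀ (n : ℕ) {G : Type} [NormedAddCommGroup G] [NormedSpace ℝ G] [FiniteDimensional ℝ G]
      (K : W × V → G),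
      K.HasTemperateGrowth → ContDiff ℝ n (fun x => ∫ w, F w • K (w, x) ∂μ) := by
  have hmeas : ∀ {G : Type} [NormedAddCommGroup G] [NormedSpace ℝ G] [FiniteDimensional ℝ G]
      (K : W × V → G) (hK : Continuous K) (x : V),
      AEStronglyMeasurable (fun w => F w • K (w, x)) μ := by
    intro G _ _ _ K hK x
    have : ProperSpace W := FiniteDimensional.proper ℝ W
    have : SecondCountableTopology W := secondCountable_of_proper
    exact hFm.smul ((hK.comp (Continuous.prodMk_left x)).aestronglyMeasurable)
  have main : ∀ {G : Type} [NormedAddCommGroup G] [NormedSpace ℝ G] [FiniteDimensional ℝ G]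
      (K : W × V → G) (hK : K.HasTemperateGrowth) (x : V),
      HasFDerivAt (fun x => ∫ w, F w • K (w, x) ∂μ)
        (∫ w, F w • (fderiv ℝ K (w,x)).comp (ContinuousLinearMap.inr ℝ W V) ∂μ) x := by
    intro G _ _ _ K hK x
    obtain ⟨k, C, hC, hb⟩ := PI_bound hK
    have hK' : (fun p => (fderiv ℝ K p).comp (ContinuousLinearMap.inr ℝ W V)).HasTemperateGrowth :=
      ((ContinuousLinearMap.compL ℝ V (W × V) G).flip
        (ContinuousLinearMap.inr ℝ W V)).hasTemperateGrowth.comp (HTG_fderiv hK)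
    obtain ⟨k', C', hC', hb'⟩ := PI_bound hK'
    refine hasFDerivAt_integral_of_dominated_of_fderiv_le (𝕜 := ℝ)
      (F := fun x w => F w • K (w, x))
      (F' := fun x w => F w • (fderiv ℝ K (w,x)).comp (ContinuousLinearMap.inr ℝ W V))
      (bound := fun w => (C' * (2 + ‖x‖)^k') * ((1 + ‖w‖)^k' * ‖F w‖))
      (Metric.ball_mem_nhds x one_pos) ?_ ?_ ?_ ?_ ?_ ?_
    · exact Eventually.of_forall fun y => hmeas K hK.1.continuous y
    · refine ((hF k).const_mul (C * (1 + ‖x‖)^k)).mono' (hmeas K hK.1.continuous x) ?_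
      refine Eventually.of_forall fun w => ?_
      rw [norm_smul]
      have := mul_le_mul_of_nonneg_left (hb w x) (norm_nonneg (F w))
      linarith
    · exact hmeas (fun p => (fderiv ℝ K p).comp (ContinuousLinearMap.inr ℝ W V)) hK'.1.continuous x
    · refine Eventually.of_forall fun w y hy => ?_
      rw [norm_smul]
      have h1 := mul_le_mul_of_nonneg_left (hb' w y) (norm_nonneg (F w))
      have h2 : ‖y‖ ≤ 1 + ‖x‖ := by
        have := norm_le_norm_add_norm_sub x y
        rw [Metric.mem_ball, dist_comm, dist_eq_norm] at hy
        linarith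
      have h3 : (1 + ‖y‖)^k' ≤ (2 + ‖x‖)^k' := pow_le_pow_left₀ (by positivity) (by linarith) _
      refine h1.trans ?_
      calc ‖F w‖ * (C' * (1 + ‖y‖)^k' * (1 + ‖w‖)^k') ≤ ‖F w‖ * (C' * (2 + ‖x‖)^k' * (1 + ‖w‖)^k') := by
            gcongr
        _ = _ := by ring
    · exact (hF k').const_mul _
    · refine Eventually.of_forall fun w y hy => ?_
      have h1 : HasFDerivAt (fun y : V => (w, y)) (ContinuousLinearMap.inr ℝ W V) y :=
        hasFDerivAt_prodMk_right w y
      have h2 : HasFDerivAt K (fderiv ℝ K (w,y)) (w,y) :=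
        ((hK.1.differentiable (by simp)) _).hasFDerivAt
      exact (h2.comp y h1).const_smul (F w)
  intro n
  induction n with
  | zero =>
    intro G _ _ _ K hK
    rw [Nat.cast_zero, contDiff_zero]
    exact continuous_iff_continuousAt.2 fun x => (main K hK x).continuousAt
  | succ n ih =>
    intro G _ _ _ K hK
    have hK' : (fun p => (fderiv ℝ K p).comp (ContinuousLinearMap.inr ℝ W V)).HasTemperateGrowth :=
      ((ContinuousLinearMap.compL ℝ V (W × V) G).flip
        (ContinuousLinearMap.inr ℝ W V)).hasTemperateGrowth.comp (HTG_fderiv hK)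
    rw [Nat.cast_succ]
    refine contDiff_succ_iff_hasFDerivAt.2 ⟨_, ih _ hK', main K hK⟩

theorem PI' {V W : Type} [NormedAddCommGroup V] [NormedSpace ℝ V] [FiniteDimensional ℝ V]
    [NormedAddCommGroup W] [NormedSpace ℝ W] [FiniteDimensional ℝ W] [MeasurableSpace W]
    [BorelSpace W] (μ : Measure W) (F : W → ℝ) (hFm : AEStronglyMeasurable F μ)
    (hF : ∀ k : ℕ, Integrable (fun w => (1 + ‖w‖)^k * ‖F w‖) μ)
      (K : W × V → ℝ) (hK : K.HasTemperateGrowth) :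
    ContDiff ℝ ∞ (fun x => ∫ w, F w * K (w, x) ∂μ) ∧ ∀ x, Integrable (fun w => F w * K (w,x)) μ := by
  refine ⟨contDiff_infty.2 fun n => PI μ F hFm hF n K hK, fun x => ?_⟩
  obtain ⟨k, C, hC, hb⟩ := PI_bound hK
  have : ProperSpace W := FiniteDimensional.proper ℝ W
  have : SecondCountableTopology W := secondCountable_of_proper
  refine ((hF k).const_mul (C * (1 + ‖x‖)^k)).mono'
    (hFm.mul ((hK.1.continuous.comp (Continuous.prodMk_left x)).aestronglyMeasurable)) ?_
  refine Eventually.of_forall fun w => ?_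
  rw [norm_mul]
  have := mul_le_mul_of_nonneg_left (hb w x) (norm_nonneg (F w))
  linarith

/-- bounded iterated derivatives imply temperate growth (one variable). -/
theorem HTG_of_bdd {c : ℝ → ℝ} (hc : ContDiff ℝ ∞ c)
    (h : ∀ n, ∃ C, ∀ x, |iteratedDeriv n c x| ≤ C) : c.HasTemperateGrowth := by
  refine ⟨hc, fun n => ?_⟩
  obtain ⟨C, hC⟩ := h n
  refine ⟨0, C, fun x => ?_⟩
  rw [norm_iteratedFDeriv_eq_norm_iteratedDeriv]
  simpa using hC x

theorem HTG_cos : Real.cos.HasTemperateGrowth :=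
  HTG_of_bdd Real.contDiff_cos fun n => ⟨1, fun x => by
    exact Real.abs_iteratedDeriv_cos_le_one n x⟩
theorem HTG_sin : Real.sin.HasTemperateGrowth :=
  HTG_of_bdd Real.contDiff_sin fun n => ⟨1, fun x => by
    exact Real.abs_iteratedDeriv_sin_le_one n x⟩
end

section
open scoped Topology ContDiff
open Filter MeasureTheory

theorem exists_entire_cos : ∃ C : ℝ → ℝ, ContDiff ℝ ∞ C ∧ ∀ z, C (z^2) = Real.cos z := by
  let c : ℕ → ℝ := fun n => (-1)^n / ((2*n).factorial : ℝ)
  have hr : (FormalMultilinearSeries.ofScalars ℝ c).radius = ⊤ := by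
    apply FormalMultilinearSeries.ofScalars_radius_eq_top_of_tendsto
    · exact Eventually.of_forall fun n => by simp only [c]; positivity
    · have h1 : ∀ n : ℕ, ‖c n.succ‖ / ‖c n‖ = 1 / ((2*(n:ℝ)+1)*(2*n+2)) := by
        intro n
        simp only [c, norm_div, norm_pow, norm_neg, norm_one, one_pow, Nat.succ_eq_add_one]
        have : (2*(n+1)).factorial = (2*n+2)*((2*n+1) * (2*n).factorial) := by
          rw [show 2*(n+1) = (2*n+1)+1 by ring, Nat.factorial_succ, Nat.factorial_succ]
        rw [this]
        have h0 : ((2*n).factorial : ℝ) ≠ 0 := by positivity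
        simp only [Real.norm_natCast]
        push_cast
        field_simp
      simp_rw [h1]
      refine squeeze_zero (fun n => by positivity) (fun n => ?_) tendsto_one_div_add_atTop_nhds_zero_nat
      apply one_div_le_one_div_of_le (by positivity)
      have : (0:ℝ) ≤ n := by positivity
      nlinarith
  refine ⟨FormalMultilinearSeries.ofScalarsSum c, ?_, ?_⟩
  · have h := (FormalMultilinearSeries.ofScalars ℝ c).hasFPowerSeriesOnBall (by rw [hr]; simp)
    rw [hr] at h
    have h2 : AnalyticOnNhd ℝ (FormalMultilinearSeries.ofScalars ℝ c).sum Set.univ := by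
      have := h.analyticOnNhd
      simpa using this
    exact h2.contDiff
  · intro z
    have h := (Real.hasSum_cos z).tsum_eq
    rw [FormalMultilinearSeries.ofScalars_sum_eq, ← h]
    congr 1
    ext n
    simp only [c, smul_eq_mul, ← pow_mul]
    ring

theorem exists_cutoff_cos : ∃ C : ℝ → ℝ, C.HasTemperateGrowth ∧ ∀ z, C (z^2) = Real.cos z := by
  obtain ⟨C, hC, hcos⟩ := exists_entire_cos
  have hD : ∀ n u, HasDerivAt (iteratedDeriv n C) (iteratedDeriv (n+1) C u) u := by
    intro n u
    rw [iteratedDeriv_succ]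
    exact ((hC.differentiable_iteratedDeriv n (by exact_mod_cast (WithTop.coe_lt_top n))) u).hasDerivAt
  have e1 : ∀ z, 2 * z * iteratedDeriv 1 C (z^2) = - Real.sin z := by
    intro z
    have h1 : HasDerivAt (fun z : ℝ => iteratedDeriv 0 C (z^2)) (iteratedDeriv 1 C (z^2) * (2*z)) z := by
      have := (hD 0 (z^2)).comp z (hasDerivAt_pow 2 z)
      exact this.congr_deriv (by simp)
    have h2 : (fun z : ℝ => iteratedDeriv 0 C (z^2)) = Real.cos := by
      ext z; simp [hcos]
    rw [h2] at h1
    have := h1.unique (Real.hasDerivAt_cos z)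
    linarith
  have e2 : ∀ z, 4 * z^2 * iteratedDeriv 2 C (z^2) + 2 * iteratedDeriv 1 C (z^2) + C (z^2) = 0 := by
    intro z
    have h1 : HasDerivAt (fun z : ℝ => 2 * z * iteratedDeriv 1 C (z^2))
        (2 * iteratedDeriv 1 C (z^2) + 2 * z * (iteratedDeriv 2 C (z^2) * (2*z))) z := by
      have h := (hD 1 (z^2)).comp z (hasDerivAt_pow 2 z)
      have h' : HasDerivAt (fun z : ℝ => 2 * z) 2 z := by simpa using (hasDerivAt_id z).const_mul 2
      have := h'.mul h
      exact this.congr_deriv (by simp)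
    have h2 : (fun z : ℝ => 2 * z * iteratedDeriv 1 C (z^2)) = fun z => - Real.sin z := by
      ext z; rw [e1]
    rw [h2] at h1
    have := h1.unique (Real.hasDerivAt_sin z).neg
    rw [hcos]; linarith
  have ode : ∀ n : ℕ, ∀ u : ℝ, 0 < u → 4 * u * iteratedDeriv (n+2) C u
      + (4*n+2) * iteratedDeriv (n+1) C u + iteratedDeriv n C u = 0 := by
    intro n
    induction n with
    | zero =>
      intro u hu
      have := e2 (Real.sqrt u)
      rw [Real.sq_sqrt hu.le] at this
      simp only [zero_add, iteratedDeriv_zero]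
      push_cast; linarith
    | succ n ih =>
      intro u hu
      have h1 : HasDerivAt (fun u => 4 * u * iteratedDeriv (n+2) C u
          + (4*n+2) * iteratedDeriv (n+1) C u + iteratedDeriv n C u)
          (4 * iteratedDeriv (n+2) C u + 4 * u * iteratedDeriv (n+2+1) C u
          + (4*n+2) * iteratedDeriv (n+1+1) C u + iteratedDeriv (n+1) C u) u := by
        have h' : HasDerivAt (fun z : ℝ => 4 * z) 4 u := by simpa using (hasDerivAt_id u).const_mul 4
        exact ((h'.mul (hD (n+2) u)).add ((hD (n+1) u).const_mul _)).add (hD n u)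
      have h2 : (fun u => 4 * u * iteratedDeriv (n+2) C u
          + (4*n+2) * iteratedDeriv (n+1) C u + iteratedDeriv n C u) =ᶠ[𝓝 u] fun _ => 0 := by
        filter_upwards [Ioi_mem_nhds hu] with v hv using ih v hv
      have := (h2.hasDerivAt_iff.1 h1).unique (hasDerivAt_const u 0)
      push_cast
      rw [show n+1+2 = n+2+1 by ring]
      rw [show n+1+1 = n+2 by ring] at this ⊢
      linarith
  have bd : ∀ n : ℕ, (∃ B, ∀ u, 1 ≤ u → |iteratedDeriv n C u| ≤ B) ∧
      (∃ B, ∀ u, 1 ≤ u → |iteratedDeriv (n+1) C u| ≤ B) := by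
    intro n
    induction n with
    | zero =>
      refine ⟨⟨1, fun u hu => ?_⟩, ⟨1, fun u hu => ?_⟩⟩
      · have := hcos (Real.sqrt u)
        rw [Real.sq_sqrt (by linarith)] at this
        rw [iteratedDeriv_zero, this]
        exact Real.abs_cos_le_one _
      · have := e1 (Real.sqrt u)
        rw [Real.sq_sqrt (by linarith)] at this
        have h1 : 1 ≤ Real.sqrt u := Real.one_le_sqrt.2 hu
        have h2 : |2 * √u * iteratedDeriv 1 C u| ≤ 1 := by
          rw [this, abs_neg]; exact Real.abs_sin_le_one _
        rw [abs_mul, abs_of_pos (by linarith : 0 < 2 * √u)] at h2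
        have := abs_nonneg (iteratedDeriv 1 C u)
        simp only [zero_add]
        nlinarith
    | succ n ih =>
      obtain ⟨⟨B0, h0⟩, ⟨B1, h1⟩⟩ := ih
      refine ⟨⟨B1, h1⟩, ⟨(4*n+2)*B1 + B0, fun u hu => ?_⟩⟩
      have o := ode n u (by linarith)
      have a0 := h0 u hu
      have a1 := h1 u hu
      have : |4 * u * iteratedDeriv (n+2) C u| ≤ (4*n+2)*B1 + B0 := by
        rw [show 4 * u * iteratedDeriv (n+2) C u = -((4*n+2) * iteratedDeriv (n+1) C u) - iteratedDeriv n C u by linarith]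
        refine (abs_sub _ _).trans ?_
        rw [abs_neg, abs_mul, abs_of_nonneg (by positivity : (0:ℝ) ≤ 4*n+2)]
        gcongr
      rw [abs_mul, abs_of_pos (by linarith : 0 < 4 * u)] at this
      have := abs_nonneg (iteratedDeriv (n+2) C u)
      rw [show n+1+1 = n+2 by ring]
      nlinarith
  let χ : ℝ → ℝ := fun u => Real.smoothTransition (u + 2)
  have hχ : ContDiff ℝ ∞ χ := Real.smoothTransition.contDiff.comp (contDiff_id.add contDiff_const)
  refine ⟨fun u => C u * χ u, HTG_of_bdd (hC.mul hχ) ?_, ?_⟩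
  · intro n
    obtain ⟨⟨B, hB⟩, -⟩ := bd n
    have hcont : Continuous (iteratedDeriv n (fun u => C u * χ u)) :=
      (hC.mul hχ).continuous_iteratedDeriv n (by exact_mod_cast le_top)
    obtain ⟨B', hB'⟩ := (isCompact_Icc (a := (-3:ℝ)) (b := 1)).exists_bound_of_continuousOn
      hcont.continuousOn
    refine ⟨max (max B B') 0, fun x => ?_⟩
    rcases le_or_gt 1 x with hx | hx
    · have : (fun u => C u * χ u) =ᶠ[𝓝 x] C := by
        filter_upwards [Ioi_mem_nhds (show (0:ℝ) < x by linarith)] with v hv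
        have hv : 0 < v := hv
        simp only [χ]
        rw [Real.smoothTransition.one_of_one_le (by linarith), mul_one]
      rw [this.iteratedDeriv_eq]
      exact (hB x hx).trans (by simp)
    · rcases le_or_gt (-3) x with hx' | hx'
      · exact (hB' x ⟨hx', hx.le⟩).trans (by simp)
      · have : (fun u => C u * χ u) =ᶠ[𝓝 x] fun _ => 0 := by
          filter_upwards [Iio_mem_nhds hx'] with v hv
          have hv : v < -3 := hv
          simp only [χ]
          rw [Real.smoothTransition.zero_of_nonpos (by linarith), mul_zero]
        rw [this.iteratedDeriv_eq]
        simp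
  · intro z
    simp only [χ]
    rw [Real.smoothTransition.one_of_one_le (by nlinarith [sq_nonneg z]), mul_one, hcos]
end

section
open scoped Topology ContDiff FourierTransform
open Filter MeasureTheory

theorem weight_int (F : SchwartzMap (EuclideanSpace ℝ (Fin 3)) ℂ) (k : ℕ) :
    Integrable (fun w => (1 + ‖w‖)^k * ‖F w‖) := by
  have h1 : Integrable (fun w => (2:ℝ)^(k-1) * (‖w‖^0 * ‖F w‖ + ‖w‖^k * ‖F w‖)) :=
    ((F.integrable_pow_mul volume 0).add (F.integrable_pow_mul volume k)).const_mul _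
  refine h1.mono' ?_ ?_
  · have := F.continuous
    exact Continuous.aestronglyMeasurable (by fun_prop)
  · refine Eventually.of_forall fun w => ?_
    rw [Real.norm_of_nonneg (by positivity)]
    have := add_pow_le (zero_le_one) (norm_nonneg w) k
    calc (1 + ‖w‖)^k * ‖F w‖ ≤ (2^(k-1) * (1^k + ‖w‖^k)) * ‖F w‖ := by gcongr
      _ = _ := by simp; ring

abbrev E3w := EuclideanSpace ℝ (Fin 3)

theorem whitney_decomp (H : ℝ × ℝ × ℝ → ℝ) (hH : ContDiff ℝ ∞ H) :
    ∃ g1 g2 : ℝ × ℝ × ℝ → ℝ, ContDiff ℝ ∞ g1 ∧ ContDiff ℝ ∞ g2 ∧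
      ∀ᶠ q in 𝓝 (0 : ℝ × ℝ × ℝ), H q = g1 (q.1, q.2.1, q.2.2^2) + q.2.2 * g2 (q.1, q.2.1, q.2.2^2) := by
  obtain ⟨C, hC, hcos⟩ := exists_cutoff_cos
  let π' : E3w → ℝ × ℝ × ℝ := fun x => (x 0, x 1, x 2)
  have hπ : ContDiff ℝ ∞ π' := by fun_prop
  let χ : ContDiffBump (0 : E3w) := ⟨1, 2, one_pos, one_lt_two⟩
  let f : E3w → ℂ := fun x => ((χ x * H (π' x) : ℝ) : ℂ)
  have hf : ContDiff ℝ ∞ f :=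
    Complex.ofRealCLM.contDiff.comp (χ.contDiff.mul (hH.comp hπ))
  have hfs : HasCompactSupport f := by
    have h1 : HasCompactSupport (fun x => χ x * H (π' x)) := χ.hasCompactSupport.mul_right
    exact h1.comp_left (g := fun r : ℝ => (r : ℂ)) (by simp)
  let S := hfs.toSchwartzMap hf
  let F := 𝓕 S
  have hinv : ∀ x, f x = ∫ w, Complex.exp ((↑(2 * Real.pi * inner ℝ w x) * Complex.I)) • F w := by
    intro x
    rw [← Real.fourierInv_eq', ← SchwartzMap.fourierInv_coe, FourierTransform.fourierInv_fourier_eq]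
    rfl
  let A : E3w → ℝ := fun w => (F w).re
  let B : E3w → ℝ := fun w => (F w).im
  have hFc := F.continuous
  have hAm : AEStronglyMeasurable A volume := (Complex.continuous_re.comp hFc).aestronglyMeasurable
  have hBm : AEStronglyMeasurable B volume := (Complex.continuous_im.comp hFc).aestronglyMeasurable
  have hA : ∀ k : ℕ, Integrable (fun w => (1 + ‖w‖)^k * ‖A w‖) := by
    intro k
    refine (weight_int F k).mono' (AEStronglyMeasurable.mul
      (Continuous.aestronglyMeasurable (by fun_prop)) hAm.norm) ?_
    refine Eventually.of_forall fun w => ?_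
    rw [Real.norm_of_nonneg (by positivity)]
    gcongr
    exact Complex.abs_re_le_norm _
  have hB : ∀ k : ℕ, Integrable (fun w => (1 + ‖w‖)^k * ‖B w‖) := by
    intro k
    refine (weight_int F k).mono' (AEStronglyMeasurable.mul
      (Continuous.aestronglyMeasurable (by fun_prop)) hBm.norm) ?_
    refine Eventually.of_forall fun w => ?_
    rw [Real.norm_of_nonneg (by positivity)]
    gcongr
    exact Complex.abs_im_le_norm _
  -- coordinates
  have w0 : ∀ i, (fun p : E3w × (ℝ × ℝ × ℝ) => p.1 i).HasTemperateGrowth := fun i =>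
    ((EuclideanSpace.proj (𝕜 := ℝ) i).comp (ContinuousLinearMap.fst ℝ E3w (ℝ × ℝ × ℝ))).hasTemperateGrowth
  have x1 : (fun p : E3w × (ℝ × ℝ × ℝ) => p.2.1).HasTemperateGrowth :=
    ((ContinuousLinearMap.fst ℝ ℝ (ℝ × ℝ)).comp (ContinuousLinearMap.snd ℝ E3w (ℝ × ℝ × ℝ))).hasTemperateGrowth
  have x2 : (fun p : E3w × (ℝ × ℝ × ℝ) => p.2.2.1).HasTemperateGrowth :=
    (((ContinuousLinearMap.fst ℝ ℝ ℝ).comp (ContinuousLinearMap.snd ℝ ℝ (ℝ × ℝ))).comp (ContinuousLinearMap.snd ℝ E3w (ℝ × ℝ × ℝ))).hasTemperateGrowth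
  have x3 : (fun p : E3w × (ℝ × ℝ × ℝ) => p.2.2.2).HasTemperateGrowth :=
    (((ContinuousLinearMap.snd ℝ ℝ ℝ).comp (ContinuousLinearMap.snd ℝ ℝ (ℝ × ℝ))).comp (ContinuousLinearMap.snd ℝ E3w (ℝ × ℝ × ℝ))).hasTemperateGrowth
  let θ : E3w × (ℝ × ℝ × ℝ) → ℝ := fun p => (2 * Real.pi) * (p.1 0 * p.2.1 + p.1 1 * p.2.2.1)
  let σ : E3w × (ℝ × ℝ × ℝ) → ℝ := fun p => (2 * Real.pi * p.1 2)^2 * p.2.2.2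
  have hθ : θ.HasTemperateGrowth :=
    (Function.HasTemperateGrowth.const _).mul (((w0 0).mul x1).add ((w0 1).mul x2))
  have hτ : (fun p : E3w × (ℝ × ℝ × ℝ) => 2 * Real.pi * p.1 2).HasTemperateGrowth :=
    (Function.HasTemperateGrowth.const _).mul (w0 2)
  have hσ : σ.HasTemperateGrowth := (hτ.pow 2).mul x3
  have hC' : (deriv C).HasTemperateGrowth := by
    have := ((ContinuousLinearMap.apply ℝ ℝ (1:ℝ)).hasTemperateGrowth).comp (HTG_fderiv hC)
    convert! this using 1
  have hsin : ∀ z, Real.sin z = - 2 * z * deriv C (z^2) := by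
    intro z
    have h1 : HasDerivAt (fun z : ℝ => C (z^2)) (deriv C (z^2) * (2*z)) z := by
      have := ((hC.1.differentiable (by simp)) (z^2)).hasDerivAt.comp z (hasDerivAt_pow 2 z)
      exact this.congr_deriv (by simp)
    have h2 : (fun z : ℝ => C (z^2)) = Real.cos := by ext z; simp [hcos]
    rw [h2] at h1
    have := h1.unique (Real.hasDerivAt_cos z)
    linarith
  let K1 : E3w × (ℝ × ℝ × ℝ) → ℝ := fun p => Real.cos (θ p) * C (σ p)
  let K2 : E3w × (ℝ × ℝ × ℝ) → ℝ := fun p => - (Real.sin (θ p) * C (σ p))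
  let K3 : E3w × (ℝ × ℝ × ℝ) → ℝ := fun p => 2 * ((2 * Real.pi * p.1 2) * (Real.sin (θ p) * deriv C (σ p)))
  let K4 : E3w × (ℝ × ℝ × ℝ) → ℝ := fun p => 2 * ((2 * Real.pi * p.1 2) * (Real.cos (θ p) * deriv C (σ p)))
  have hK1 : K1.HasTemperateGrowth := (HTG_cos.comp hθ).mul (hC.comp hσ)
  have hK2 : K2.HasTemperateGrowth := ((HTG_sin.comp hθ).mul (hC.comp hσ)).neg
  have hK3 : K3.HasTemperateGrowth := (Function.HasTemperateGrowth.const _).mul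
    (hτ.mul ((HTG_sin.comp hθ).mul (hC'.comp hσ)))
  have hK4 : K4.HasTemperateGrowth := (Function.HasTemperateGrowth.const _).mul
    (hτ.mul ((HTG_cos.comp hθ).mul (hC'.comp hσ)))
  obtain ⟨s1, i1⟩ := PI' volume A hAm hA K1 hK1
  obtain ⟨s2, i2⟩ := PI' volume B hBm hB K2 hK2
  obtain ⟨s3, i3⟩ := PI' volume A hAm hA K3 hK3
  obtain ⟨s4, i4⟩ := PI' volume B hBm hB K4 hK4
  refine ⟨_, _, s1.add s2, s3.add s4, ?_⟩
  have hrep : ∀ q : ℝ × ℝ × ℝ, χ (!₂[q.1, q.2.1, q.2.2]) * H q = ((∫ w, A w * K1 (w, (q.1, q.2.1, q.2.2^2)))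
      + ∫ w, B w * K2 (w, (q.1, q.2.1, q.2.2^2))) + q.2.2 * ((∫ w, A w * K3 (w, (q.1, q.2.1, q.2.2^2)))
      + ∫ w, B w * K4 (w, (q.1, q.2.1, q.2.2^2))) := by
    rintro ⟨t, s, z⟩
    let u : ℝ × ℝ × ℝ := (t, s, z^2)
    have h := hinv (!₂[t, s, z])
    have hInt : Integrable (fun w => Complex.exp ((↑(2 * Real.pi * inner ℝ w !₂[t,s,z]) * Complex.I)) • F w) := by
      refine (F.integrable (μ := volume)).norm.mono' ?_ ?_
      · exact Continuous.aestronglyMeasurable (by fun_prop)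
      · exact Eventually.of_forall fun w => by
          rw [norm_smul, Complex.norm_exp_ofReal_mul_I, one_mul]
    have h' := congrArg Complex.re h
    have e1 : (f !₂[t,s,z]).re = χ !₂[t,s,z] * H (t,s,z) := by
      simp [f, π']
    rw [e1] at h'
    change χ !₂[t,s,z] * H (t,s,z) = _
    have e2 : (∫ w, Complex.exp ((↑(2 * Real.pi * inner ℝ w !₂[t,s,z]) * Complex.I)) • F w).re
      = ∫ w, (Complex.exp ((↑(2 * Real.pi * inner ℝ w !₂[t,s,z]) * Complex.I)) • F w).re :=
      (Complex.reCLM.integral_comp_comm hInt).symm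
    rw [h', e2]
    change _ = ((∫ w, A w * K1 (w, u)) + ∫ w, B w * K2 (w, u)) + z * ((∫ w, A w * K3 (w, u))
      + ∫ w, B w * K4 (w, u))
    rw [← integral_add (i1 u) (i2 u), ← integral_add (i3 u) (i4 u), ← integral_const_mul,
      ← integral_add (f := fun a => A a * K1 (a,u) + B a * K2 (a,u))
        (g := fun a => z * (A a * K3 (a,u) + B a * K4 (a,u)))
        ((i1 u).add (i2 u)) (((i3 u).add (i4 u)).const_mul z)]
    congr 1
    ext w
    have hin : 2 * Real.pi * inner ℝ w !₂[t,s,z] = θ (w, u) + 2 * Real.pi * w 2 * z := by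
      simp [θ, u, PiLp.inner_apply, Fin.sum_univ_three]
      ring
    have hσe : σ (w, u) = (2 * Real.pi * w 2 * z)^2 := by simp only [σ, u]; ring
    rw [hin, smul_eq_mul, Complex.mul_re, Complex.exp_ofReal_mul_I_re, Complex.exp_ofReal_mul_I_im,
      Real.cos_add, Real.sin_add]
    simp only [K1, K2, K3, K4, A, B, hσe]
    rw [hcos]
    have := hsin (2 * Real.pi * w 2 * z)
    rw [this]
    ring
  have hev : ∀ᶠ q in 𝓝 (0 : ℝ × ℝ × ℝ), χ (!₂[q.1, q.2.1, q.2.2]) = 1 := by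
    have hc : ContinuousAt (fun q : ℝ × ℝ × ℝ => (!₂[q.1, q.2.1, q.2.2] : E3w)) 0 := by
      apply Continuous.continuousAt
      apply (PiLp.continuous_toLp 2 _).comp
      refine continuous_pi fun i => ?_
      fin_cases i <;> simp <;> fun_prop
    have h0 : (!₂[(0 : ℝ × ℝ × ℝ).1, (0 : ℝ × ℝ × ℝ).2.1, (0 : ℝ × ℝ × ℝ).2.2] : E3w) = 0 := by
      ext i; fin_cases i <;> simp
    have h1 : ∀ᶠ x in 𝓝 (0 : E3w), χ x = 1 := χ.eventuallyEq_one
    have h2 := hc.tendsto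
    rw [h0] at h2
    exact h2.eventually h1
  filter_upwards [hev] with q hq
  have := hrep q
  rw [hq, one_mul] at this
  exact this

theorem hadamard (H : ℝ × ℝ × ℝ → ℝ) (hH : ContDiff ℝ ∞ H) :
    ∃ k : ℝ × ℝ × ℝ → ℝ, ContDiff ℝ ∞ k ∧
      (∀ᶠ q in 𝓝 (0 : ℝ × ℝ × ℝ), H q = H (q.1, q.2.1, 0) + q.2.2 * k q) ∧
      ∀ᶠ q in 𝓝 (0 : ℝ × ℝ × ℝ), k (q.1, q.2.1, 0) = fderiv ℝ H (q.1, q.2.1, 0) (0,0,1) := by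
  let χ : ContDiffBump (0 : ℝ × ℝ × ℝ) := ⟨1, 2, one_pos, one_lt_two⟩
  let f : ℝ × ℝ × ℝ → ℝ := fun x => χ x * H x
  have hf : ContDiff ℝ ∞ f := χ.contDiff.mul hH
  have hfs : HasCompactSupport f := χ.hasCompactSupport.mul_right
  have hft := hfs.hasTemperateGrowth hf
  let F : ℝ → ℝ := Set.indicator (Set.Icc 0 1) 1
  have hft1 : (fun q => fderiv ℝ f q (0,0,1)).HasTemperateGrowth :=
    ((ContinuousLinearMap.apply ℝ ℝ ((0,0,1):ℝ×ℝ×ℝ)).hasTemperateGrowth).comp (HTG_fderiv hft)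
  have w0 : (fun p : ℝ × (ℝ × ℝ × ℝ) => p.1).HasTemperateGrowth := 
    (ContinuousLinearMap.fst ℝ ℝ (ℝ × ℝ × ℝ)).hasTemperateGrowth
  have x3 : (fun p : ℝ × (ℝ × ℝ × ℝ) => p.2.2.2).HasTemperateGrowth :=
    (((ContinuousLinearMap.snd ℝ ℝ ℝ).comp (ContinuousLinearMap.snd ℝ ℝ (ℝ × ℝ))).comp (ContinuousLinearMap.snd ℝ ℝ (ℝ × ℝ × ℝ))).hasTemperateGrowth
  let L1 : ℝ × (ℝ × ℝ × ℝ) →L[ℝ] ℝ × ℝ × ℝ :=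
    ((ContinuousLinearMap.fst ℝ ℝ (ℝ × ℝ)).prod
      (((ContinuousLinearMap.fst ℝ ℝ ℝ).comp (ContinuousLinearMap.snd ℝ ℝ (ℝ × ℝ))).prod 0)).comp
      (ContinuousLinearMap.snd ℝ ℝ (ℝ × ℝ × ℝ))
  let L2 : ℝ →L[ℝ] ℝ × ℝ × ℝ := (0 : ℝ →L[ℝ] ℝ).prod ((0 : ℝ →L[ℝ] ℝ).prod (ContinuousLinearMap.id ℝ ℝ))
  have hm : (fun p : ℝ × (ℝ × ℝ × ℝ) => ((p.2.1, p.2.2.1, p.1 * p.2.2.2) : ℝ × ℝ × ℝ)).HasTemperateGrowth := by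
    have := L1.hasTemperateGrowth.add (L2.hasTemperateGrowth.comp (w0.mul x3))
    convert this using 1
    ext p <;> simp [L1, L2]
  obtain ⟨s1, i1⟩ := PI' (volume : Measure ℝ) F
    ((measurable_one.indicator measurableSet_Icc).aestronglyMeasurable)
    (by
      intro k
      have h1 : IntegrableOn (fun w : ℝ => (1 + ‖w‖)^k) (Set.Icc 0 1) :=
        (Continuous.integrableOn_Icc (by fun_prop))
      have h2 := h1.integrable_indicator measurableSet_Icc
      convert! h2 using 1
      ext w
      by_cases hw : w ∈ Set.Icc (0:ℝ) 1 <;> simp [F, hw])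
    _ (hft1.comp hm)
  have hk : ∀ q : ℝ × ℝ × ℝ, (∫ w, F w * fderiv ℝ f (q.1, q.2.1, w * q.2.2) (0,0,1))
      = ∫ w in (0:ℝ)..1, fderiv ℝ f (q.1, q.2.1, w * q.2.2) (0,0,1) := by
    intro q
    rw [intervalIntegral.integral_of_le zero_le_one, ← integral_Icc_eq_integral_Ioc,
      ← integral_indicator measurableSet_Icc]
    congr 1
    ext w
    by_cases hw : w ∈ Set.Icc (0:ℝ) 1 <;> simp [F, hw]
  have hχ : ∀ᶠ x in 𝓝 (0 : ℝ × ℝ × ℝ), χ x = 1 := χ.eventuallyEq_one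
  have hpr : Tendsto (fun q : ℝ × ℝ × ℝ => ((q.1, q.2.1, 0) : ℝ × ℝ × ℝ)) (𝓝 0) (𝓝 0) := by
    have : Continuous (fun q : ℝ × ℝ × ℝ => ((q.1, q.2.1, 0) : ℝ × ℝ × ℝ)) := by fun_prop
    exact this.tendsto' _ _ rfl
  refine ⟨_, s1, ?_, ?_⟩
  · filter_upwards [hχ, hpr.eventually hχ] with q hq hq'
    have hq1 : H q = f q := by simp [f, hq]
    have hq2 : H (q.1, q.2.1, 0) = f (q.1, q.2.1, 0) := by simp only [f, hq', one_mul]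
    rw [hq1, hq2]
    have hderiv : ∀ w : ℝ, HasDerivAt (fun w : ℝ => f (q.1, q.2.1, w * q.2.2))
        (q.2.2 * fderiv ℝ f (q.1, q.2.1, w * q.2.2) (0,0,1)) w := by
      intro w
      have h1 : HasDerivAt (fun w : ℝ => ((q.1, q.2.1, w * q.2.2) : ℝ × ℝ × ℝ)) (0, 0, q.2.2) w := by
        refine (hasDerivAt_const w q.1).prodMk ((hasDerivAt_const w q.2.1).prodMk ?_)
        simpa using (hasDerivAt_id w).mul_const q.2.2
      have h2 := ((hf.differentiable (by simp)) (q.1, q.2.1, w * q.2.2)).hasFDerivAt.comp_hasDerivAt w h1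
      have h3 : ((0, 0, q.2.2) : ℝ × ℝ × ℝ) = q.2.2 • (0,0,1) := by ext <;> simp
      rw [h3, map_smul] at h2
      exact h2
    have hcont : Continuous (fun w : ℝ => q.2.2 * fderiv ℝ f (q.1, q.2.1, w * q.2.2) (0,0,1)) :=
      continuous_const.mul (hft1.1.continuous.comp (by fun_prop))
    have := intervalIntegral.integral_eq_sub_of_hasDerivAt (a := 0) (b := 1)
      (fun w _ => hderiv w) (hcont.intervalIntegrable _ _)
    rw [intervalIntegral.integral_const_mul] at this
    have e := hk q
    simp only [Function.comp_apply] at e ⊢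
    rw [e, this]
    simp
  · have hχ' : ∀ᶠ x in 𝓝 (0 : ℝ × ℝ × ℝ), f =ᶠ[𝓝 x] H := by
      filter_upwards [hχ.eventually_nhds] with x hx
      filter_upwards [hx] with y hy
      simp [f, hy]
    filter_upwards [hpr.eventually hχ'] with q hq
    have e := hk (q.1, q.2.1, 0)
    simp only [Function.comp_apply] at e ⊢
    rw [e, ← hq.fderiv_eq]
    simp
end

section
open scoped Topology ContDiff
open Filter

theorem germ_extend {E G : Type*} [NormedAddCommGroup E] [NormedSpace ℝ E] [FiniteDimensional ℝ E]
    [NormedAddCommGroup G] [NormedSpace ℝ G] {F : E → G}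
    (h : ∀ᶠ q in 𝓝 (0:E), ContDiffAt ℝ ∞ F q) :
    ∃ H : E → G, ContDiff ℝ ∞ H ∧ H =ᶠ[𝓝 0] F := by
  obtain ⟨r, hr, hb⟩ := Metric.eventually_nhds_iff_ball.1 h
  let χ : ContDiffBump (0 : E) := ⟨r/3, r/2, by positivity, by linarith⟩
  refine ⟨fun x => χ x • F x, ?_, ?_⟩
  · rw [contDiff_iff_contDiffAt]
    intro x
    by_cases hx : x ∈ Metric.ball (0:E) r
    · exact χ.contDiff.contDiffAt.smul (hb x hx)
    · have h1 : x ∉ tsupport χ := by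
        rw [χ.tsupport_eq]
        simp only [Metric.mem_closedBall, Metric.mem_ball, dist_zero_right, not_le, not_lt, χ] at hx ⊢
        linarith
      have h2 : (fun x => χ x • F x) =ᶠ[𝓝 x] fun _ => 0 := by
        filter_upwards [notMem_tsupport_iff_eventuallyEq.1 h1] with y hy
        simp [hy]
      exact contDiffAt_const.congr_of_eventuallyEq h2
  · filter_upwards [χ.eventuallyEq_one] with x hx
    simp [hx]

theorem local_inverse {E : Type*} [NormedAddCommGroup E] [NormedSpace ℝ E] [FiniteDimensional ℝ E]
    {φ : E → E} (hφ : ContDiff ℝ ∞ φ) (h0 : φ 0 = 0)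
    (hb : Function.Injective (fderiv ℝ φ 0)) :
    ∃ ψ : E → E, ContDiff ℝ ∞ ψ ∧ ψ 0 = 0 ∧ (∀ᶠ q in 𝓝 0, ψ (φ q) = q) ∧
      ∀ᶠ q in 𝓝 0, φ (ψ q) = q := by
  have hsurj : Function.Surjective (fderiv ℝ φ 0) :=
    (LinearMap.injective_iff_surjective (f := (fderiv ℝ φ 0).toLinearMap)).1 hb
  let e : E ≃L[ℝ] E := (LinearEquiv.ofBijective (fderiv ℝ φ 0).toLinearMap ⟨hb, hsurj⟩).toContinuousLinearEquiv
  have he : HasFDerivAt φ (e : E →L[ℝ] E) 0 := by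
    have := (hφ.differentiable (by simp) 0).hasFDerivAt
    convert this using 1
    ext v; rfl
  have hc : ContDiffAt ℝ ∞ φ 0 := hφ.contDiffAt
  let P := hc.toOpenPartialHomeomorph φ he (by simp)
  have hP : (P : E → E) = φ := rfl
  have h0s : (0:E) ∈ P.source := hc.mem_toOpenPartialHomeomorph_source he (by simp)
  have h0t : (0:E) ∈ P.target := by
    have := P.map_source h0s
    rwa [hP, h0] at this
  have hs0 : P.symm 0 = 0 := by
    have := P.left_inv h0s
    rwa [hP, h0] at this
  have hcs : ContinuousAt P.symm 0 := P.continuousAt_symm h0t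
  -- nearby points have invertible derivative
  have hinv : ∀ᶠ q in 𝓝 (0:E), ∃ e' : E ≃L[ℝ] E, (e' : E →L[ℝ] E) = fderiv ℝ φ q := by
    have hcd : ContinuousAt (fderiv ℝ φ) 0 := (hφ.continuous_fderiv (by simp)).continuousAt
    have : Set.range ((↑) : (E ≃L[ℝ] E) → (E →L[ℝ] E)) ∈ 𝓝 (fderiv ℝ φ 0) := by
      have := ContinuousLinearEquiv.nhds e
      rwa [he.fderiv]
    exact hcd this
  have hsm : ∀ᶠ q in 𝓝 (0:E), ContDiffAt ℝ ∞ P.symm q := by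
    have hcs' : Tendsto P.symm (𝓝 0) (𝓝 0) := by
      have := hcs.tendsto; rwa [hs0] at this
    filter_upwards [hcs'.eventually hinv, P.open_target.mem_nhds h0t] with q ⟨e', he'⟩ hq
    refine P.contDiffAt_symm hq (f₀' := e') ?_ hφ.contDiffAt
    rw [hP, he']
    exact (hφ.differentiable (by simp) _).hasFDerivAt
  obtain ⟨ψ, hψ, hψe⟩ := germ_extend hsm
  refine ⟨ψ, hψ, by rw [hψe.self_of_nhds, hs0], ?_, ?_⟩
  · have : Tendsto φ (𝓝 0) (𝓝 0) := by
      have := hφ.continuous.continuousAt (x := 0) |>.tendsto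
      rwa [h0] at this
    filter_upwards [this.eventually hψe, P.open_source.mem_nhds h0s] with q hq hs
    rw [hq]; exact P.left_inv hs
  · filter_upwards [hψe, P.open_target.mem_nhds h0t] with q hq hs
    rw [hq]; exact P.right_inv hs

theorem diffeo_of_inj {E : Type*} [NormedAddCommGroup E] [NormedSpace ℝ E] [FiniteDimensional ℝ E]
    {φ : E → E} {p : E} {L : E →L[ℝ] E} (hφ : ContDiffAt ℝ ∞ φ p) (h : HasFDerivAt φ L p)
    (hb : ∀ v, L v = 0 → v = 0) : IsDiffeoGermAt φ p := by
  refine ⟨hφ, ?_⟩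
  rw [h.fderiv]
  have hi : Function.Injective L := (injective_iff_map_eq_zero L).2 hb
  exact ⟨hi, (LinearMap.injective_iff_surjective (f := L.toLinearMap)).1 hi⟩

theorem IsDiffeoGermAt.comp' {E : Type*} [NormedAddCommGroup E] [NormedSpace ℝ E]
    {φ ψ : E → E} {p q : E} (h1 : IsDiffeoGermAt ψ q) (h2 : IsDiffeoGermAt φ p) (hq : φ p = q) :
    IsDiffeoGermAt (ψ ∘ φ) p := by
  subst hq
  refine ⟨h1.1.comp p h2.1, ?_⟩
  rw [fderiv_comp p (h1.1.differentiableAt (by simp)) (h2.1.differentiableAt (by simp))]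
  exact h1.2.comp h2.2

theorem AEquivAt.trans' {f g h : ℝ × ℝ × ℝ → E4} (h1 : AEquivAt f 0 g) (h2 : AEquivAt g 0 h) :
    AEquivAt f 0 h := by
  obtain ⟨φ, Φ, a, b, c, d, e⟩ := h1
  obtain ⟨φ', Φ', a', b', c', d', e'⟩ := h2
  refine ⟨φ' ∘ φ, Φ' ∘ Φ, a'.comp' a c, b'.comp' b d, by simp [c, c'], by simp [d, d'], ?_⟩
  have : Tendsto φ (𝓝 0) (𝓝 0) := by
    have := a.1.continuousAt.tendsto
    rwa [c] at this
  filter_upwards [e, this.eventually e'] with q hq hq'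
  simp [hq, hq']

theorem AEquivAt.of_eventuallyEq {f g : ℝ × ℝ × ℝ → E4} (h : f =ᶠ[𝓝 0] g) :
    AEquivAt f 0 g := by
  refine ⟨id, id, ⟨contDiffAt_id, ?_⟩, ⟨contDiffAt_id, ?_⟩, rfl, h.self_of_nhds, ?_⟩
  · simp [fderiv_id, Function.bijective_id]
  · simp [fderiv_id, Function.bijective_id]
  · filter_upwards [h] with q hq using hq
end

section
open scoped Topology ContDiff
open Filter

/-- The model map `(t,s,z) ↦ (t,s,z²,z³ b(t,s,z²))`. -/
def gmod (b : ℝ × ℝ × ℝ → ℝ) : ℝ × ℝ × ℝ → E4 :=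
  fun q => ![q.1, q.2.1, q.2.2^2, q.2.2^3 * b (q.1, q.2.1, q.2.2^2)]

theorem gmod_zero (b : ℝ × ℝ × ℝ → ℝ) : gmod b 0 = 0 := by
  ext i; fin_cases i <;> simp [gmod]

theorem lin3 (L : ℝ × ℝ × ℝ →L[ℝ] ℝ) (v : ℝ × ℝ × ℝ) :
    L v = v.1 * L (1,0,0) + v.2.1 * L (0,1,0) + v.2.2 * L (0,0,1) := by
  have : v = v.1 • (1,0,0) + v.2.1 • (0,1,0) + v.2.2 • ((0,0,1) : ℝ × ℝ × ℝ) := by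
    ext <;> simp
  conv_lhs => rw [this]
  simp only [map_add, map_smul, smul_eq_mul]

theorem contDiff_vec4 {E : Type*} [NormedAddCommGroup E] [NormedSpace ℝ E] {n : WithTop ℕ∞} {a b c d : E → ℝ}
    (ha : ContDiff ℝ n a) (hb : ContDiff ℝ n b) (hc : ContDiff ℝ n c) (hd : ContDiff ℝ n d) :
    ContDiff ℝ n (fun x => (![a x, b x, c x, d x] : E4)) := by
  rw [contDiff_pi]
  intro i
  fin_cases i <;> simpa

theorem hasFDerivAt_vec4 {E : Type*} [NormedAddCommGroup E] [NormedSpace ℝ E] {a b c d : E → ℝ}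
    {a' b' c' d' : E →L[ℝ] ℝ} {x : E}
    (ha : HasFDerivAt a a' x) (hb : HasFDerivAt b b' x) (hc : HasFDerivAt c c' x)
    (hd : HasFDerivAt d d' x) :
    HasFDerivAt (fun x => (![a x, b x, c x, d x] : E4)) (ContinuousLinearMap.pi ![a',b',c',d']) x := by
  rw [hasFDerivAt_pi']
  intro i
  fin_cases i
  · exact ha
  · exact hb
  · exact hc
  · exact hd

theorem sq_map_deriv : HasFDerivAt (fun q : ℝ × ℝ × ℝ => ((q.1, q.2.1, q.2.2^2) : ℝ × ℝ × ℝ))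
    ((ContinuousLinearMap.fst ℝ ℝ (ℝ × ℝ)).prod
      (((ContinuousLinearMap.fst ℝ ℝ ℝ).comp (ContinuousLinearMap.snd ℝ ℝ (ℝ × ℝ))).prod 0)) 0 := by
  have h1 : HasFDerivAt (fun q : ℝ × ℝ × ℝ => q.2.1)
    ((ContinuousLinearMap.fst ℝ ℝ ℝ).comp (ContinuousLinearMap.snd ℝ ℝ (ℝ × ℝ))) 0 :=
    ((ContinuousLinearMap.fst ℝ ℝ ℝ).comp (ContinuousLinearMap.snd ℝ ℝ (ℝ × ℝ))).hasFDerivAt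
  have h2 : HasFDerivAt (fun q : ℝ × ℝ × ℝ => q.2.2)
    ((ContinuousLinearMap.snd ℝ ℝ ℝ).comp (ContinuousLinearMap.snd ℝ ℝ (ℝ × ℝ))) 0 :=
    ((ContinuousLinearMap.snd ℝ ℝ ℝ).comp (ContinuousLinearMap.snd ℝ ℝ (ℝ × ℝ))).hasFDerivAt
  have h3 := h2.pow 2
  simp at h3
  exact hasFDerivAt_fst.prodMk (h1.prodMk h3)

theorem gmod_std (b : ℝ × ℝ × ℝ → ℝ) (hb : ContDiff ℝ ∞ b) (h0 : b 0 = 0)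
    (h : fderiv ℝ b 0 (1,0,0) ≠ 0 ∨ fderiv ℝ b 0 (0,1,0) ≠ 0) :
    AEquivAt (gmod b) 0 (fun q => ![q.1, q.2.1, q.2.2^2, q.2.1 * q.2.2^3]) := by
  have hdb : HasFDerivAt b (fderiv ℝ b 0) 0 := (hb.differentiable (by simp) 0).hasFDerivAt
  have hm := sq_map_deriv
  have hbm : HasFDerivAt (fun q : ℝ × ℝ × ℝ => b (q.1, q.2.1, q.2.2^2))
      ((fderiv ℝ b 0).comp ((ContinuousLinearMap.fst ℝ ℝ (ℝ × ℝ)).prod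
      (((ContinuousLinearMap.fst ℝ ℝ ℝ).comp (ContinuousLinearMap.snd ℝ ℝ (ℝ × ℝ))).prod 0))) 0 := by
    refine HasFDerivAt.comp (g := b) (g' := fderiv ℝ b 0) (0 : ℝ × ℝ × ℝ) ?_ hm
    have e : (((0 : ℝ × ℝ × ℝ).1, (0 : ℝ × ℝ × ℝ).2.1, (0 : ℝ × ℝ × ℝ).2.2^2) : ℝ × ℝ × ℝ) = 0 := by
      simp [Prod.ext_iff]
    rw [e]; exact hdb
  have hz : HasFDerivAt (fun q : ℝ × ℝ × ℝ => q.2.2)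
    ((ContinuousLinearMap.snd ℝ ℝ ℝ).comp (ContinuousLinearMap.snd ℝ ℝ (ℝ × ℝ))) 0 :=
    ((ContinuousLinearMap.snd ℝ ℝ ℝ).comp (ContinuousLinearMap.snd ℝ ℝ (ℝ × ℝ))).hasFDerivAt
  have hs : HasFDerivAt (fun q : ℝ × ℝ × ℝ => q.2.1)
    ((ContinuousLinearMap.fst ℝ ℝ ℝ).comp (ContinuousLinearMap.snd ℝ ℝ (ℝ × ℝ))) 0 :=
    ((ContinuousLinearMap.fst ℝ ℝ ℝ).comp (ContinuousLinearMap.snd ℝ ℝ (ℝ × ℝ))).hasFDerivAt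
  have hbm' : ContDiff ℝ ∞ (fun q : ℝ × ℝ × ℝ => b (q.1, q.2.1, q.2.2^2)) := hb.comp (by fun_prop)
  let pr : Fin 4 → (E4 →L[ℝ] ℝ) := fun i => ContinuousLinearMap.proj i
  have hpr : ∀ i, HasFDerivAt (fun x : E4 => x i) (pr i) 0 := fun i => (pr i).hasFDerivAt
  have hBp : HasFDerivAt (fun x : E4 => b (x 0, x 1, x 2))
      ((fderiv ℝ b 0).comp ((pr 0).prod ((pr 1).prod (pr 2)))) 0 := by
    refine HasFDerivAt.comp (g := b) (g' := fderiv ℝ b 0) (0 : E4) ?_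
      ((hpr 0).prodMk ((hpr 1).prodMk (hpr 2)))
    exact hdb
  have hBp' : ContDiff ℝ ∞ (fun x : E4 => b (x 0, x 1, x 2)) := hb.comp (by fun_prop)
  have h0' : b (0,0,0) = 0 := h0
  by_cases hbs : fderiv ℝ b 0 (0,1,0) = 0
  · have hbt : fderiv ℝ b 0 (1,0,0) ≠ 0 := by tauto
    refine ⟨fun q => (q.2.1, b (q.1, q.2.1, q.2.2^2), q.2.2),
      fun x => ![x 1, b (x 0, x 1, x 2), x 2, x 3], ?_, ?_, ?_, ?_, ?_⟩
    · refine diffeo_of_inj (ContDiff.contDiffAt (by fun_prop)) (hs.prodMk (hbm.prodMk hz)) ?_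
      rintro ⟨t, s, z⟩ hv
      simp [Prod.ext_iff] at hv
      obtain ⟨h1, h2, h3⟩ := hv
      rw [lin3] at h2
      simp [h1, hbt] at h2
      simp [h1, h2, h3]
    · rw [gmod_zero]
      refine diffeo_of_inj (ContDiff.contDiffAt (contDiff_vec4 (by fun_prop) hBp' (by fun_prop) (by fun_prop)))
        (hasFDerivAt_vec4 (hpr 1) hBp (hpr 2) (hpr 3)) ?_
      intro v hv
      have e0 := congrFun hv 0
      have e1 := congrFun hv 1
      have e2 := congrFun hv 2
      have e3 := congrFun hv 3
      simp [pr] at e0 e1 e2 e3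
      rw [lin3] at e1
      simp [e0, e2, hbt] at e1
      ext i; fin_cases i <;> simp [e0, e1, e2, e3]
    · simp [h0']
    · rw [gmod_zero]
      ext i; fin_cases i <;> simp [h0']
    · refine Eventually.of_forall fun q => ?_
      ext i; fin_cases i <;> simp [gmod]
      ring
  · refine ⟨fun q => (q.1, b (q.1, q.2.1, q.2.2^2), q.2.2),
      fun x => ![x 0, b (x 0, x 1, x 2), x 2, x 3], ?_, ?_, ?_, ?_, ?_⟩
    · refine diffeo_of_inj (ContDiff.contDiffAt (by fun_prop)) (hasFDerivAt_fst.prodMk (hbm.prodMk hz)) ?_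
      rintro ⟨t, s, z⟩ hv
      simp [Prod.ext_iff] at hv
      obtain ⟨h1, h2, h3⟩ := hv
      rw [lin3] at h2
      simp [h1, hbs] at h2
      simp [h1, h2, h3]
    · rw [gmod_zero]
      refine diffeo_of_inj (ContDiff.contDiffAt (contDiff_vec4 (by fun_prop) hBp' (by fun_prop) (by fun_prop)))
        (hasFDerivAt_vec4 (hpr 0) hBp (hpr 2) (hpr 3)) ?_
      intro v hv
      have e0 := congrFun hv 0
      have e1 := congrFun hv 1
      have e2 := congrFun hv 2
      have e3 := congrFun hv 3
      simp [pr] at e0 e1 e2 e3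
      rw [lin3] at e1
      simp [e0, e2, hbs] at e1
      ext i; fin_cases i <;> simp [e0, e1, e2, e3]
    · simp [h0']
    · rw [gmod_zero]
      ext i; fin_cases i <;> simp [h0']
    · refine Eventually.of_forall fun q => ?_
      ext i; fin_cases i <;> simp [gmod]
      ring
end

section
open scoped Topology ContDiff
open Filter

theorem normal_form_A3 (G : ℝ × ℝ × ℝ → E4) (a b' g0 k0 : ℝ × ℝ × ℝ → ℝ)
    (ha : ContDiff ℝ ∞ a) (hb' : ContDiff ℝ ∞ b') (hg0 : ContDiff ℝ ∞ g0) (hk0 : ContDiff ℝ ∞ k0)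
    (ha0 : a 0 ≠ 0) (hg00 : g0 0 = 0) (hk00 : k0 0 = 0)
    (hG : ∀ᶠ q in 𝓝 (0 : ℝ × ℝ × ℝ), G q = ![q.1, q.2.1, g0 (q.1, q.2.1, 0) + q.2.2^2 * a q,
      k0 (q.1, q.2.1, 0) + q.2.2^2 * b' q]) :
    ∃ b : ℝ × ℝ × ℝ → ℝ, ContDiff ℝ ∞ b ∧ AEquivAt G 0 (gmod b) := by
  obtain ⟨ε, hε, hεa⟩ : ∃ ε : ℝ, ε * ε = 1 ∧ 0 < ε * a 0 := by
    rcases lt_or_gt_of_ne ha0 with h | h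
    · exact ⟨-1, by norm_num, by linarith⟩
    · exact ⟨1, by norm_num, by linarith⟩
  have hpos : ∀ᶠ q in 𝓝 (0 : ℝ × ℝ × ℝ), 0 < ε * a q :=
    (continuous_const.mul ha.continuous).continuousAt.eventually (lt_mem_nhds hεa)
  obtain ⟨R, hR, hRe⟩ := germ_extend (F := fun q => Real.sqrt (ε * a q)) (by
    filter_upwards [hpos] with q hq
    exact (contDiffAt_const.mul ha.contDiffAt).sqrt hq.ne')
  have hR0 : 0 < R 0 := by rw [hRe.self_of_nhds]; exact Real.sqrt_pos.2 hεa
  have hR2 : ∀ᶠ q in 𝓝 (0 : ℝ × ℝ × ℝ), R q ^ 2 = ε * a q := by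
    filter_upwards [hRe, hpos] with q hq hq'
    rw [hq, Real.sq_sqrt hq'.le]
  have hRpos : ∀ᶠ q in 𝓝 (0 : ℝ × ℝ × ℝ), 0 < R q :=
    hR.continuous.continuousAt.eventually (lt_mem_nhds hR0)
  let φ : ℝ × ℝ × ℝ → ℝ × ℝ × ℝ := fun q => (q.1, q.2.1, q.2.2 * R q)
  have hφ : ContDiff ℝ ∞ φ := by fun_prop
  have hφ0 : φ 0 = 0 := by simp [φ]
  have hz : HasFDerivAt (fun q : ℝ × ℝ × ℝ => q.2.2)
    ((ContinuousLinearMap.snd ℝ ℝ ℝ).comp (ContinuousLinearMap.snd ℝ ℝ (ℝ × ℝ))) 0 :=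
    ((ContinuousLinearMap.snd ℝ ℝ ℝ).comp (ContinuousLinearMap.snd ℝ ℝ (ℝ × ℝ))).hasFDerivAt
  have hs : HasFDerivAt (fun q : ℝ × ℝ × ℝ => q.2.1)
    ((ContinuousLinearMap.fst ℝ ℝ ℝ).comp (ContinuousLinearMap.snd ℝ ℝ (ℝ × ℝ))) 0 :=
    ((ContinuousLinearMap.fst ℝ ℝ ℝ).comp (ContinuousLinearMap.snd ℝ ℝ (ℝ × ℝ))).hasFDerivAt
  have hφd : IsDiffeoGermAt φ 0 := by
    have h3 := hz.mul (hR.differentiable (by simp) 0).hasFDerivAt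
    refine diffeo_of_inj hφ.contDiffAt (hasFDerivAt_fst.prodMk (hs.prodMk h3)) ?_
    rintro ⟨t, s, z⟩ hv
    simp [Prod.ext_iff, hR0.ne'] at hv
    obtain ⟨h1, h2, h3⟩ := hv
    simp [h1, h2, h3]
  obtain ⟨ψ, hψ, hψ0, hψφ, hφψ⟩ := local_inverse hφ hφ0 hφd.2.1
  have hψt : Tendsto ψ (𝓝 0) (𝓝 0) := by
    have := hψ.continuous.continuousAt (x := 0) |>.tendsto
    rwa [hψ0] at this
  have hφt : Tendsto φ (𝓝 0) (𝓝 0) := by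
    have := hφ.continuous.continuousAt (x := 0) |>.tendsto
    rwa [hφ0] at this
  obtain ⟨c, hc, hce⟩ := germ_extend (F := fun q => b' (ψ q) / (R (ψ q))^2) (by
    filter_upwards [hψt.eventually hRpos] with q hq
    exact (hb'.comp hψ).contDiffAt.div ((hR.comp hψ).pow 2).contDiffAt (by simp [hq.ne']))
  obtain ⟨g1, g2, hg1, hg2, hdec⟩ := whitney_decomp c hc
  refine ⟨g2, hg2, ?_⟩
  let X : E4 → ℝ := fun x => ε * (x 2 - g0 (x 0, x 1, 0))
  have hX : ContDiff ℝ ∞ X := by fun_prop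
  let Φ : E4 → E4 := fun x => ![x 0, x 1, X x, x 3 - k0 (x 0, x 1, 0) - X x * g1 (x 0, x 1, X x)]
  have hΦ : ContDiff ℝ ∞ Φ := contDiff_vec4 (by fun_prop) (by fun_prop) hX (by fun_prop)
  have hG0 : G 0 = 0 := by
    rw [hG.self_of_nhds]
    have h1 : g0 (0,0,0) = 0 := hg00
    have h2 : k0 (0,0,0) = 0 := hk00
    ext i; fin_cases i <;> simp [h1, h2]
  refine ⟨φ, Φ, hφd, ?_, hφ0, ?_, ?_⟩
  · rw [hG0]
    let pr : Fin 4 → (E4 →L[ℝ] ℝ) := fun i => ContinuousLinearMap.proj i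
    have hpr : ∀ i, HasFDerivAt (fun x : E4 => x i) (pr i) 0 := fun i => (pr i).hasFDerivAt
    have hP : HasFDerivAt (fun x : E4 => ((x 0, x 1, 0) : ℝ × ℝ × ℝ))
        ((pr 0).prod ((pr 1).prod 0)) 0 :=
      (hpr 0).prodMk ((hpr 1).prodMk (hasFDerivAt_const 0 _))
    have hgP : HasFDerivAt (fun x : E4 => g0 (x 0, x 1, 0))
        ((fderiv ℝ g0 0).comp ((pr 0).prod ((pr 1).prod 0))) 0 :=
      HasFDerivAt.comp (g := g0) (g' := fderiv ℝ g0 0) (0 : E4)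
        (hg0.differentiable (by simp) 0).hasFDerivAt hP
    have hkP : HasFDerivAt (fun x : E4 => k0 (x 0, x 1, 0))
        ((fderiv ℝ k0 0).comp ((pr 0).prod ((pr 1).prod 0))) 0 :=
      HasFDerivAt.comp (g := k0) (g' := fderiv ℝ k0 0) (0 : E4)
        (hk0.differentiable (by simp) 0).hasFDerivAt hP
    have hXd : HasFDerivAt X (ε • (pr 2 - (fderiv ℝ g0 0).comp ((pr 0).prod ((pr 1).prod 0)))) 0 :=
      ((hpr 2).sub hgP).const_mul ε
    have hgX : ContDiff ℝ ∞ (fun x : E4 => g1 (x 0, x 1, X x)) := by fun_prop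
    have hXm := hXd.mul (hgX.differentiable (by simp) 0).hasFDerivAt
    have hX0 : X 0 = 0 := by
      have h1 : g0 (0,0,0) = 0 := hg00
      simp [X, h1]
    refine diffeo_of_inj hΦ.contDiffAt
      (hasFDerivAt_vec4 (hpr 0) (hpr 1) hXd (((hpr 3).sub hkP).sub hXm)) ?_
    intro v hv
    have e0 := congrFun hv 0
    have e1 := congrFun hv 1
    have e2 := congrFun hv 2
    have e3 := congrFun hv 3
    have hε0 : ε ≠ 0 := by rintro rfl; simp at hε
    have hz3 : ((0,0,0) : ℝ × ℝ × ℝ) = 0 := rfl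
    simp [pr] at e0 e1
    simp [pr, e0, e1, hε0, hz3] at e2
    simp [pr, e0, e1, e2, hz3, hX0] at e3
    ext i; fin_cases i <;> simp [e0, e1, e2, e3]
  · rw [hG0, gmod_zero]
    have h1 : g0 (0,0,0) = 0 := hg00
    have h2 : k0 (0,0,0) = 0 := hk00
    ext i; fin_cases i <;> simp [Φ, X, h1, h2]
  · filter_upwards [hG, hR2, hRpos, hφt.eventually hce, hφt.eventually hdec, hψφ] with q h1 h2 h3 h4 h5 h6
    rw [h6] at h4
    have e1 : q.2.2^2 * b' q = (q.2.2 * R q)^2 * c (φ q) := by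
      rw [h4]; field_simp
    have e2 : X (G q) = (q.2.2 * R q)^2 := by
      rw [h1]
      simp only [X]
      simp
      rw [mul_pow, h2]; ring
    have e3 : c (φ q) = g1 (q.1, q.2.1, (q.2.2 * R q)^2) + (q.2.2 * R q) * g2 (q.1, q.2.1, (q.2.2 * R q)^2) := h5
    ext i
    fin_cases i
    · simp [Φ, gmod, φ, h1]
    · simp [Φ, gmod, φ, h1]
    · simp [Φ, gmod, φ, e2]
    · simp only [Φ, gmod, φ, e2]
      rw [h1]
      simp
      rw [e1, e3]; ring
end

section
open scoped Topology ContDiff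
open Filter

theorem hadamard2 (H : ℝ × ℝ × ℝ → ℝ) (hH : ContDiff ℝ ∞ H)
    (h : ∀ᶠ q in 𝓝 (0 : ℝ × ℝ × ℝ), fderiv ℝ H (q.1, q.2.1, 0) (0,0,1) = 0) :
    ∃ a : ℝ × ℝ × ℝ → ℝ, ContDiff ℝ ∞ a ∧
      ∀ᶠ q in 𝓝 (0 : ℝ × ℝ × ℝ), H q = H (q.1, q.2.1, 0) + q.2.2^2 * a q := by
  obtain ⟨k, hk, h1, h2⟩ := hadamard H hH
  obtain ⟨a, ha, h3, -⟩ := hadamard k hk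
  refine ⟨a, ha, ?_⟩
  filter_upwards [h, h1, h2, h3] with q e e1 e2 e3
  rw [e1, e3, e2, e]; ring

theorem hasDerivAt_mul_zero {u v : ℝ → ℝ} (hu : DifferentiableAt ℝ u 0) (hv : DifferentiableAt ℝ v 0)
    (u0 : u 0 = 0) (v0 : v 0 = 0) : HasDerivAt (fun x => u x * v x) 0 0 := by
  have := hu.hasDerivAt.mul hv.hasDerivAt
  simp only [u0, v0, mul_zero, zero_mul, add_zero] at this
  exact this

theorem second_deriv_zero (H a : ℝ × ℝ × ℝ → ℝ) (hH : ContDiff ℝ ∞ H)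
    (n0 n1 l α : ℝ → ℝ) (h0 : ContDiff ℝ ∞ n0) (h1 : ContDiff ℝ ∞ n1) (hl : ContDiff ℝ ∞ l)
    (hα : ContDiff ℝ ∞ α) (z0 : n0 0 = 0) (z1 : n1 0 = 0) (zl : l 0 = 0) (zα : α 0 = 0)
    (d0 : deriv n0 0 = 0) (d1 : deriv n1 0 = 0)
    (Ht : fderiv ℝ H 0 (1,0,0) = 0) (Hs : fderiv ℝ H 0 (0,1,0) = 0)
    (m : ℝ → ℝ) (hm : m =ᶠ[𝓝 0] fun x => H (n0 x, n1 x, 0) + (l x)^2 * α x) :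
    deriv (deriv m) 0 = 0 := by
  have hd : deriv m =ᶠ[𝓝 0] fun x => deriv n0 x * fderiv ℝ H (n0 x, n1 x, 0) (1,0,0)
      + deriv n1 x * fderiv ℝ H (n0 x, n1 x, 0) (0,1,0) + l x * (2 * deriv l x * α x + l x * deriv α x) := by
    refine hm.deriv.trans (Eventually.of_forall fun x => ?_)
    have e0 := (h0.differentiable (by simp) x).hasDerivAt
    have e1 := (h1.differentiable (by simp) x).hasDerivAt
    have el := (hl.differentiable (by simp) x).hasDerivAt
    have eα := (hα.differentiable (by simp) x).hasDerivAt
    have hp := e0.prodMk (e1.prodMk (hasDerivAt_const x (0:ℝ)))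
    have hH' := (hH.differentiable (by simp) (n0 x, n1 x, 0)).hasFDerivAt.comp_hasDerivAt x hp
    have := hH'.add ((el.pow 2).mul eα)
    rw [lin3] at this
    refine this.deriv.trans ?_
    simp
    ring
  rw [hd.deriv_eq]
  have c0 : ContDiff ℝ ∞ (deriv n0) := by
    have := (contDiff_infty_iff_deriv.1 h0).2; exact this
  have c1 : ContDiff ℝ ∞ (deriv n1) := (contDiff_infty_iff_deriv.1 h1).2
  have cl : ContDiff ℝ ∞ (deriv l) := (contDiff_infty_iff_deriv.1 hl).2
  have cα : ContDiff ℝ ∞ (deriv α) := (contDiff_infty_iff_deriv.1 hα).2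
  have cH : ContDiff ℝ ∞ (fderiv ℝ H) := hH.fderiv_right (by simp)
  have cH0 : ∀ v, ContDiff ℝ ∞ (fun x => fderiv ℝ H (n0 x, n1 x, 0) v) := fun v =>
    (cH.comp (by fun_prop)).clm_apply contDiff_const
  have hz : ((n0 0, n1 0, 0) : ℝ × ℝ × ℝ) = 0 := by simp [z0, z1]
  have A := hasDerivAt_mul_zero (c0.differentiable (by simp) 0) ((cH0 (1,0,0)).differentiable (by simp) 0)
    d0 (by rw [hz, Ht])
  have B := hasDerivAt_mul_zero (c1.differentiable (by simp) 0) ((cH0 (0,1,0)).differentiable (by simp) 0)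
    d1 (by rw [hz, Hs])
  have C := hasDerivAt_mul_zero (hl.differentiable (by simp) 0)
    (v := fun x => 2 * deriv l x * α x + l x * deriv α x)
    (ContDiff.differentiable (n := ∞) (by fun_prop) (by simp) 0) zl (by simp [zl, zα])
  have := ((A.add B).add C).deriv
  exact this.trans (by simp)

theorem normal_form_A2 (F : ℝ × ℝ × ℝ → E4) (l : ℝ × ℝ × ℝ → ℝ)
    (hF : ContDiff ℝ ∞ F) (hl : ContDiff ℝ ∞ l) (hF0 : F 0 = 0) (hl0 : l 0 = 0)
    (hFt : fderiv ℝ F 0 (1,0,0) = ![1,0,0,0]) (hFs : fderiv ℝ F 0 (0,1,0) = ![0,1,0,0])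
    (hFz : fderiv ℝ F 0 (0,0,1) = 0)
    (hzz : deriv (fun x : ℝ => fderiv ℝ F (0,0,x) (0,0,1) 2) 0 ≠ 0)
    (hlz : fderiv ℝ l 0 (0,0,1) ≠ 0)
    (hker : ∀ᶠ q in 𝓝 (0 : ℝ × ℝ × ℝ), l q = 0 → ∃ v : ℝ × ℝ × ℝ, v ≠ 0 ∧ fderiv ℝ F q v = 0) :
    ∃ b : ℝ × ℝ × ℝ → ℝ, ContDiff ℝ ∞ b ∧ AEquivAt F 0 (gmod b) := by
  have hFi : ∀ i, ContDiff ℝ ∞ (fun q => F q i) := fun i => (contDiff_pi.1 hF) i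
  have hFd : ∀ q, HasFDerivAt F (fderiv ℝ F q) q := fun q => (hF.differentiable (by simp) q).hasFDerivAt
  have hFdi : ∀ i q, HasFDerivAt (fun q => F q i) ((ContinuousLinearMap.proj i).comp (fderiv ℝ F q)) q :=
    fun i q => (hasFDerivAt_pi'.1 (hFd q)) i
  have hld : ∀ q, HasFDerivAt l (fderiv ℝ l q) q := fun q => (hl.differentiable (by simp) q).hasFDerivAt
  let φ : ℝ × ℝ × ℝ → ℝ × ℝ × ℝ := fun q => (F q 0, F q 1, l q)
  have hφ : ContDiff ℝ ∞ φ := by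
    exact (hFi 0).prodMk ((hFi 1).prodMk hl)
  have hφ0 : φ 0 = 0 := by simp [φ, hF0, hl0]
  have hlinF : ∀ v : ℝ × ℝ × ℝ, fderiv ℝ F 0 v = ![v.1, v.2.1, 0, 0] := by
    intro v
    have : v = v.1 • (1,0,0) + v.2.1 • (0,1,0) + v.2.2 • ((0,0,1) : ℝ × ℝ × ℝ) := by
      ext <;> simp
    conv_lhs => rw [this]
    simp only [map_add, map_smul, hFt, hFs, hFz]
    ext i; fin_cases i <;> simp
  have hφd : IsDiffeoGermAt φ 0 := by
    refine diffeo_of_inj hφ.contDiffAt ((hFdi 0 0).prodMk ((hFdi 1 0).prodMk (hld 0))) ?_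
    rintro ⟨t, s, z⟩ hv
    simp [Prod.ext_iff, hlinF] at hv
    obtain ⟨h1, h2, h3⟩ := hv
    rw [lin3] at h3
    simp [h1, h2, hlz] at h3
    simp [h1, h2, h3]
  obtain ⟨ψ, hψ, hψ0, hψφ, hφψ⟩ := local_inverse hφ hφ0 hφd.2.1
  have hψt : Tendsto ψ (𝓝 0) (𝓝 0) := by
    have := hψ.continuous.continuousAt (x := 0) |>.tendsto
    rwa [hψ0] at this
  have hφt : Tendsto φ (𝓝 0) (𝓝 0) := by
    have := hφ.continuous.continuousAt (x := 0) |>.tendsto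
    rwa [hφ0] at this
  let G : ℝ × ℝ × ℝ → E4 := fun q => F (ψ q)
  have hG : ContDiff ℝ ∞ G := hF.comp hψ
  have hGi : ∀ i, ContDiff ℝ ∞ (fun q => G q i) := fun i => (contDiff_pi.1 hG) i
  have hGd : ∀ q, HasFDerivAt G (fderiv ℝ G q) q := fun q => (hG.differentiable (by simp) q).hasFDerivAt
  have hGdi : ∀ i q, HasFDerivAt (fun q => G q i) ((ContinuousLinearMap.proj i).comp (fderiv ℝ G q)) q :=
    fun i q => (hasFDerivAt_pi'.1 (hGd q)) i
  have hG01 : ∀ᶠ q in 𝓝 (0 : ℝ × ℝ × ℝ), G q 0 = q.1 ∧ G q 1 = q.2.1 ∧ l (ψ q) = q.2.2 := by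
    filter_upwards [hφψ] with q hq
    exact ⟨congrArg Prod.fst hq, congrArg (fun p => p.2.1) hq, congrArg (fun p => p.2.2) hq⟩
  have hpr : Tendsto (fun q : ℝ × ℝ × ℝ => ((q.1, q.2.1, 0) : ℝ × ℝ × ℝ)) (𝓝 0) (𝓝 0) := by
    have : Continuous (fun q : ℝ × ℝ × ℝ => ((q.1, q.2.1, 0) : ℝ × ℝ × ℝ)) := by fun_prop
    exact this.tendsto' _ _ rfl
  have hdz : ∀ᶠ q in 𝓝 (0 : ℝ × ℝ × ℝ), q.2.2 = 0 → fderiv ℝ G q (0,0,1) = 0 := by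
    filter_upwards [hG01.eventually_nhds, hψt.eventually hψφ.eventually_nhds, hψt.eventually hker, hφψ]
      with q h1 h2 h3 h4 hz
    have hl' : l (ψ q) = 0 := by rw [h1.self_of_nhds.2.2, hz]
    obtain ⟨v, hv, hFv⟩ := h3 hl'
    have hφp := (hφ.differentiable (by simp) (ψ q)).hasFDerivAt
    have hψq : HasFDerivAt ψ (fderiv ℝ ψ q) (φ (ψ q)) := by
      rw [h4]; exact (hψ.differentiable (by simp) q).hasFDerivAt
    have hid : (fderiv ℝ ψ q).comp (fderiv ℝ φ (ψ q)) = ContinuousLinearMap.id ℝ _ := by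
      have e1 := hψq.comp (ψ q) hφp
      have e2 : HasFDerivAt (ψ ∘ φ) (ContinuousLinearMap.id ℝ _) (ψ q) :=
        (hasFDerivAt_id (ψ q)).congr_of_eventuallyEq h2
      exact e1.unique e2
    have hGq : fderiv ℝ G q = (fderiv ℝ F (ψ q)).comp (fderiv ℝ ψ q) :=
      ((hFd (ψ q)).comp q (hψ.differentiable (by simp) q).hasFDerivAt).fderiv
    set w := fderiv ℝ φ (ψ q) v with hw
    have hψw : fderiv ℝ ψ q w = v := DFunLike.congr_fun hid v
    have hGw : fderiv ℝ G q w = 0 := by rw [hGq]; simp [hψw, hFv]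
    have w1 : w.1 = 0 := by
      have e2 : HasFDerivAt (fun q => G q 0) (ContinuousLinearMap.fst ℝ ℝ (ℝ × ℝ)) q :=
        hasFDerivAt_fst.congr_of_eventuallyEq (h1.mono fun x hx => hx.1)
      have := DFunLike.congr_fun ((hGdi 0 q).unique e2) w
      simpa [hGw] using this.symm
    have w2 : w.2.1 = 0 := by
      have hs : HasFDerivAt (fun q : ℝ × ℝ × ℝ => q.2.1)
        ((ContinuousLinearMap.fst ℝ ℝ ℝ).comp (ContinuousLinearMap.snd ℝ ℝ (ℝ × ℝ))) q :=
        ((ContinuousLinearMap.fst ℝ ℝ ℝ).comp (ContinuousLinearMap.snd ℝ ℝ (ℝ × ℝ))).hasFDerivAt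
      have e2 := hs.congr_of_eventuallyEq (f₁ := fun q => G q 1) (h1.mono fun x hx => hx.2.1)
      have := DFunLike.congr_fun ((hGdi 1 q).unique e2) w
      simpa [hGw] using this.symm
    have w3 : w.2.2 ≠ 0 := by
      intro h
      have : w = 0 := by ext <;> simp [w1, w2, h]
      rw [this, map_zero] at hψw
      exact hv hψw.symm
    have hwe : w = w.2.2 • (0,0,1) := by ext <;> simp [w1, w2]
    rw [hwe, map_smul] at hGw
    exact (smul_eq_zero.1 hGw).resolve_left w3
  have hdzi : ∀ i, ∀ᶠ q in 𝓝 (0 : ℝ × ℝ × ℝ), fderiv ℝ (fun q => G q i) (q.1, q.2.1, 0) (0,0,1) = 0 := by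
    intro i
    filter_upwards [hpr.eventually hdz] with q hq
    rw [(hGdi i _).fderiv]
    simp [hq rfl]
  obtain ⟨a, ha, hae⟩ := hadamard2 _ (hGi 2) (hdzi 2)
  obtain ⟨b', hb', hbe⟩ := hadamard2 _ (hGi 3) (hdzi 3)
  have hG0 : G 0 = 0 := by simp [G, hψ0, hF0]
  have hGe : ∀ᶠ q in 𝓝 (0 : ℝ × ℝ × ℝ), G q = ![q.1, q.2.1, (fun q => G q 2) (q.1, q.2.1, 0) + q.2.2^2 * a q,
      (fun q => G q 3) (q.1, q.2.1, 0) + q.2.2^2 * b' q] := by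
    filter_upwards [hG01, hae, hbe] with q h1 h2 h3
    ext i
    fin_cases i
    · exact h1.1
    · exact h1.2.1
    · exact h2
    · exact h3
  have hFG : ∀ᶠ q in 𝓝 (0 : ℝ × ℝ × ℝ), F q = G (φ q) := by
    filter_upwards [hψφ] with q hq
    simp [G, hq]
  have ha0 : a 0 ≠ 0 := by
    intro ha0
    apply hzz
    have hc : ContDiff ℝ ∞ (fun x : ℝ => ((0,0,x) : ℝ × ℝ × ℝ)) := by fun_prop
    have hcd : ∀ x : ℝ, HasDerivAt (fun x : ℝ => ((0,0,x) : ℝ × ℝ × ℝ)) (0,0,1) x := fun x =>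
      (hasDerivAt_const x 0).prodMk ((hasDerivAt_const x 0).prodMk (hasDerivAt_id x))
    have hct : Tendsto (fun x : ℝ => ((0,0,x) : ℝ × ℝ × ℝ)) (𝓝 0) (𝓝 0) :=
      hc.continuous.tendsto' _ _ rfl
    have hd : ∀ i (x : ℝ), HasDerivAt (fun x : ℝ => F (0,0,x) i) (fderiv ℝ F (0,0,x) (0,0,1) i) x :=
      fun i x => by
        have := HasFDerivAt.comp_hasDerivAt (l := fun q => F q i) x (hFdi i (0,0,x)) (hcd x)
        exact this
    have e : (fun x : ℝ => fderiv ℝ F (0,0,x) (0,0,1) 2) = deriv (fun x : ℝ => F (0,0,x) 2) := by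
      ext x; exact (hd 2 x).deriv.symm
    have hz3 : ((0,0,0) : ℝ × ℝ × ℝ) = 0 := rfl
    have hFH : ∀ᶠ q in 𝓝 (0 : ℝ × ℝ × ℝ), F q 2 = (fun q => G q 2) (F q 0, F q 1, 0) + (l q)^2 * a (φ q) := by
      filter_upwards [hFG, hφt.eventually hae] with q h1 h2
      rw [← h1] at h2
      exact h2
    have hGt : ∀ v : ℝ × ℝ × ℝ, fderiv ℝ (fun q => G q 2) 0 (v.1, v.2.1, 0) = 0 := by
      intro v
      have e1 : HasFDerivAt (fun q => (fun q => G q 2) (F q 0, F q 1, 0))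
          ((fderiv ℝ (fun q => G q 2) 0).comp
            (((ContinuousLinearMap.proj 0).comp (fderiv ℝ F 0)).prod
            (((ContinuousLinearMap.proj 1).comp (fderiv ℝ F 0)).prod 0))) 0 := by
        refine HasFDerivAt.comp (g := fun q => G q 2) (0 : ℝ × ℝ × ℝ) ?_
          ((hFdi 0 0).prodMk ((hFdi 1 0).prodMk (hasFDerivAt_const 0 _)))
        have : ((F 0 0, F 0 1, 0) : ℝ × ℝ × ℝ) = 0 := by simp [hF0]
        rw [this]
        exact ((hGi 2).differentiable (by simp) 0).hasFDerivAt
      have e2 := ((hld 0).pow 2).mul ((ha.comp hφ).differentiable (by simp) 0).hasFDerivAt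
      have e3 := (hFdi 2 0).unique ((e1.add e2).congr_of_eventuallyEq hFH)
      have e4 := DFunLike.congr_fun e3 v
      simp [hlinF, hl0, hφ0, ha0] at e4
      exact e4.symm
    rw [e]
    refine second_deriv_zero (fun q => G q 2) a (hGi 2) (fun x => F (0,0,x) 0) (fun x => F (0,0,x) 1)
      (fun x => l (0,0,x)) (fun x => a (φ (0,0,x))) ((hFi 0).comp hc) ((hFi 1).comp hc) (hl.comp hc)
      ((ha.comp hφ).comp hc) ?_ ?_ ?_ ?_ ?_ ?_ ?_ ?_ _ (hct.eventually hFH)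
    · simp [hz3, hF0]
    · simp [hz3, hF0]
    · simp [hz3, hl0]
    · simp [hz3, hφ0, ha0]
    · rw [(hd 0 0).deriv, hz3, hFz]; rfl
    · rw [(hd 1 0).deriv, hz3, hFz]; rfl
    · exact hGt (1,0,0)
    · exact hGt (0,1,0)
  obtain ⟨b, hb, hbeq⟩ := normal_form_A3 G a b' _ _ ha hb' (hGi 2) (hGi 3) ha0
    (by simp [hG0]) (by simp [hG0]) hGe
  refine ⟨b, hb, AEquivAt.trans' ?_ hbeq⟩
  refine ⟨φ, id, hφd, ⟨contDiffAt_id, ?_⟩, hφ0, ?_, hFG⟩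
  · simp [fderiv_id, Function.bijective_id]
  · simp [hF0, hG0]
end

section
open scoped Topology ContDiff
open Filter

theorem det4_expand (u v w x : E4) : det4 u v w x =
   (u 0 * v 1 - u 1 * v 0) * (w 2 * x 3 - w 3 * x 2)
   - (u 0 * v 2 - u 2 * v 0) * (w 1 * x 3 - w 3 * x 1)
   + (u 0 * v 3 - u 3 * v 0) * (w 1 * x 2 - w 2 * x 1)
   + (u 1 * v 2 - u 2 * v 1) * (w 0 * x 3 - w 3 * x 0)
   - (u 1 * v 3 - u 3 * v 1) * (w 0 * x 2 - w 2 * x 0)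
   + (u 2 * v 3 - u 3 * v 2) * (w 0 * x 1 - w 1 * x 0) := by
  unfold det4
  rw [Matrix.det_succ_row_zero]
  simp [Fin.sum_univ_succ, Matrix.det_fin_three, Fin.succAbove]
  ring

theorem det4_three (r1 r2 r3 x : E4) (a b c : ℝ × ℝ × ℝ) :
   det4 (a.1 • r1 + a.2.1 • r2 + a.2.2 • r3) (b.1 • r1 + b.2.1 • r2 + b.2.2 • r3)
    (c.1 • r1 + c.2.1 • r2 + c.2.2 • r3) x =
   (a.1 * (b.2.1 * c.2.2 - b.2.2 * c.2.1) - a.2.1 * (b.1 * c.2.2 - b.2.2 * c.1)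
    + a.2.2 * (b.1 * c.2.1 - b.2.1 * c.1)) * det4 r1 r2 r3 x := by
  simp only [det4_expand, Pi.add_apply, Pi.smul_apply, smul_eq_mul]
  ring

theorem det4_eq_zero_of (u v w x : E4) (c : Fin 4 → ℝ) (hc : c ≠ 0)
    (h : c 0 • u + c 1 • v + c 2 • w + c 3 • x = 0) : det4 u v w x = 0 := by
  unfold det4
  rw [← Matrix.exists_vecMul_eq_zero_iff]
  refine ⟨c, hc, ?_⟩
  rw [Matrix.vecMul_eq_sum, Fin.sum_univ_four]
  exact h

theorem det4_ne_zero_of (u v w x : E4)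
    (h : ∀ c : Fin 4 → ℝ, c 0 • u + c 1 • v + c 2 • w + c 3 • x = 0 → c = 0) : det4 u v w x ≠ 0 := by
  unfold det4
  rw [Ne, ← Matrix.exists_vecMul_eq_zero_iff]
  rintro ⟨c, hc, h'⟩
  rw [Matrix.vecMul_eq_sum, Fin.sum_univ_four] at h'
  exact hc (h c h')

theorem lin3' (L : ℝ × ℝ × ℝ →L[ℝ] E4) (v : ℝ × ℝ × ℝ) :
    L v = v.1 • L (1,0,0) + v.2.1 • L (0,1,0) + v.2.2 • L (0,0,1) := by
  have : v = v.1 • (1,0,0) + v.2.1 • (0,1,0) + v.2.2 • ((0,0,1) : ℝ × ℝ × ℝ) := by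
    ext <;> simp
  conv_lhs => rw [this]
  simp only [map_add, map_smul]

theorem det4_contDiff {E : Type*} [NormedAddCommGroup E] [NormedSpace ℝ E] {n : WithTop ℕ∞}
    {a b c d : E → E4}
    (ha : ContDiff ℝ n a) (hb : ContDiff ℝ n b) (hc : ContDiff ℝ n c) (hd : ContDiff ℝ n d) :
    ContDiff ℝ n (fun x => det4 (a x) (b x) (c x) (d x)) := by
  simp only [det4_expand]
  rw [contDiff_pi] at ha hb hc hd
  fun_prop

/-- determinant with third argument vanishing at `0`: derivative. -/
theorem det4_deriv_third {a b c d : ℝ → E4} (ha : ContDiff ℝ ∞ a) (hb : ContDiff ℝ ∞ b)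
    (hd : ContDiff ℝ ∞ d) {c' : E4} (hc : HasDerivAt c c' 0) (hc0 : c 0 = 0) :
    HasDerivAt (fun x => det4 (a x) (b x) (c x) (d x)) (det4 (a 0) (b 0) c' (d 0)) 0 := by
  have lin : ∀ u v w x : E4, det4 u v w x = w 0 * det4 u v ![1,0,0,0] x + w 1 * det4 u v ![0,1,0,0] x
      + w 2 * det4 u v ![0,0,1,0] x + w 3 * det4 u v ![0,0,0,1] x := by
    intro u v w x
    simp only [det4_expand]
    simp
    ring
  have hC : ∀ w : E4, DifferentiableAt ℝ (fun x => det4 (a x) (b x) w (d x)) 0 := fun w =>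
    (det4_contDiff ha hb contDiff_const hd).differentiable (by simp) 0
  have hci := hasDerivAt_pi.1 hc
  have h := ((((hci 0).mul (hC ![1,0,0,0]).hasDerivAt).add ((hci 1).mul (hC ![0,1,0,0]).hasDerivAt)).add
    ((hci 2).mul (hC ![0,0,1,0]).hasDerivAt)).add ((hci 3).mul (hC ![0,0,0,1]).hasDerivAt)
  have e : (fun x => det4 (a x) (b x) (c x) (d x)) = _ := funext fun x => lin (a x) (b x) (c x) (d x)
  rw [e, lin]
  refine HasDerivAt.congr_deriv h ?_
  simp [hc0]
end

section
open scoped Topology ContDiff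
open Filter

theorem lam_zero (f ν : ℝ × ℝ × ℝ → E4) (lam : ℝ × ℝ × ℝ → ℝ)
    (hident : ∃ c : ℝ × ℝ × ℝ → ℝ, ContDiff ℝ ∞ c ∧
      (∀ᶠ q in 𝓝 (0 : ℝ × ℝ × ℝ), c q ≠ 0) ∧
      ∀ᶠ q in 𝓝 (0 : ℝ × ℝ × ℝ), lam q =
        c q * det4 (fderiv ℝ f q (1,0,0)) (fderiv ℝ f q (0,1,0))
          (fderiv ℝ f q (0,0,1)) (ν q))
    (hrank : Module.finrank ℝ ↥(LinearMap.range (fderiv ℝ f 0).toLinearMap) = 2) :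
    det4 (fderiv ℝ f 0 (1,0,0)) (fderiv ℝ f 0 (0,1,0)) (fderiv ℝ f 0 (0,0,1)) (ν 0) = 0 ∧ lam 0 = 0 := by
  obtain ⟨c, hc, hc0, hce⟩ := hident
  have h : det4 (fderiv ℝ f 0 (1,0,0)) (fderiv ℝ f 0 (0,1,0)) (fderiv ℝ f 0 (0,0,1)) (ν 0) = 0 := by
    have h1 := LinearMap.finrank_range_add_finrank_ker (fderiv ℝ f 0).toLinearMap
    rw [hrank] at h1
    have h2 : LinearMap.ker (fderiv ℝ f 0).toLinearMap ≠ ⊥ := by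
      intro h
      rw [h] at h1
      simp at h1
    obtain ⟨v, hv, hv0⟩ := Submodule.exists_mem_ne_zero_of_ne_bot h2
    have hv' : fderiv ℝ f 0 v = 0 := hv
    rw [lin3'] at hv'
    refine det4_eq_zero_of _ _ _ _ ![v.1, v.2.1, v.2.2, 0] ?_ (by simpa using hv')
    intro h
    apply hv0
    have e0 := congrFun h 0
    have e1 := congrFun h 1
    have e2 := congrFun h 2
    simp at e0 e1 e2
    ext <;> simp [e0, e1, e2]
  refine ⟨h, ?_⟩
  rw [hce.self_of_nhds, h, mul_zero]

theorem det3_ne (a b c : ℝ × ℝ × ℝ)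
    (h : ∀ t s z : ℝ, t • a + s • b + z • c = 0 → t = 0 ∧ s = 0 ∧ z = 0) :
    (a.1 * (b.2.1 * c.2.2 - b.2.2 * c.2.1) - a.2.1 * (b.1 * c.2.2 - b.2.2 * c.1)
    + a.2.2 * (b.1 * c.2.1 - b.2.1 * c.1)) ≠ 0 := by
  let M : Matrix (Fin 3) (Fin 3) ℝ := Matrix.of ![![a.1,a.2.1,a.2.2], ![b.1,b.2.1,b.2.2], ![c.1,c.2.1,c.2.2]]
  have : M.det ≠ 0 := by
    rw [Ne, ← Matrix.exists_vecMul_eq_zero_iff]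
    rintro ⟨v, hv, h'⟩
    rw [Matrix.vecMul_eq_sum, Fin.sum_univ_three] at h'
    have e0 := congrFun h' 0
    have e1 := congrFun h' 1
    have e2 := congrFun h' 2
    simp [M] at e0 e1 e2
    obtain ⟨h1, h2, h3⟩ := h (v 0) (v 1) (v 2) (by ext <;> simp [e0, e1, e2])
    apply hv
    ext i; fin_cases i <;> simp [h1, h2, h3]
  rw [Matrix.det_fin_three] at this
  simp [M] at this
  intro h
  apply this
  linarith

theorem normal_form_A1
    (f : ℝ × ℝ × ℝ → E4) (ν : ℝ × ℝ × ℝ → E4)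
    (lam : ℝ × ℝ × ℝ → ℝ) (ξ₁ ξ₂ η : ℝ × ℝ × ℝ → ℝ × ℝ × ℝ)
    (hf : ContDiff ℝ ∞ f) (hf0 : f 0 = 0)
    (hν : ContDiff ℝ ∞ ν)
    (hlam : ContDiff ℝ ∞ lam)
    (hident : ∃ c : ℝ × ℝ × ℝ → ℝ, ContDiff ℝ ∞ c ∧
      (∀ᶠ q in 𝓝 (0 : ℝ × ℝ × ℝ), c q ≠ 0) ∧
      ∀ᶠ q in 𝓝 (0 : ℝ × ℝ × ℝ), lam q =
        c q * det4 (fderiv ℝ f q (1,0,0)) (fderiv ℝ f q (0,1,0))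
          (fderiv ℝ f q (0,0,1)) (ν q))
    (hrank : Module.finrank ℝ ↥(LinearMap.range (fderiv ℝ f 0).toLinearMap) = 2)
    (hη : ContDiff ℝ ∞ η)
    (hnull : ∀ᶠ q in 𝓝 (0 : ℝ × ℝ × ℝ), lam q = 0 →
      LinearMap.ker (fderiv ℝ f q).toLinearMap = Submodule.span ℝ {η q})
    (hηlam : fderiv ℝ lam 0 (η 0) ≠ 0)
    (hind : LinearIndependent ℝ ![ξ₁ 0, ξ₂ 0])
    (htan₁ : fderiv ℝ lam 0 (ξ₁ 0) = 0)
    (htan₂ : fderiv ℝ lam 0 (ξ₂ 0) = 0) :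
    ∃ b : ℝ × ℝ × ℝ → ℝ, ContDiff ℝ ∞ b ∧ AEquivAt f 0 (gmod b) := by
  obtain ⟨hD0, hlam0⟩ := lam_zero f ν lam hident hrank
  obtain ⟨c, hc, hc0, hce⟩ := hident
  have hfd : ContDiff ℝ ∞ (fderiv ℝ f) := hf.fderiv_right (by simp)
  have hfv : ∀ v, ContDiff ℝ ∞ (fun q => fderiv ℝ f q v) := fun v => hfd.clm_apply contDiff_const
  set v1 := ξ₁ 0
  set v2 := ξ₂ 0
  set n := η 0 with hn
  have hn0 : n ≠ 0 := by intro h; rw [h] at hηlam; simp at hηlam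
  have hfn : fderiv ℝ f 0 n = 0 := by
    have h1 := hnull.self_of_nhds hlam0
    have : n ∈ LinearMap.ker (fderiv ℝ f 0).toLinearMap := by
      rw [h1]; exact Submodule.mem_span_singleton_self _
    exact this
  have hbasis : ∀ t s z : ℝ, t • v1 + s • v2 + z • n = 0 → t = 0 ∧ s = 0 ∧ z = 0 := by
    intro t s z h
    have h1 := congrArg (fderiv ℝ lam 0) h
    simp [htan₁, htan₂, hηlam] at h1
    subst h1
    have := LinearIndependent.pair_iff.1 hind t s (by simpa using h)
    exact ⟨this.1, this.2, rfl⟩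
  let M : ℝ × ℝ × ℝ →L[ℝ] ℝ × ℝ × ℝ :=
    (ContinuousLinearMap.fst ℝ ℝ (ℝ × ℝ)).smulRight v1
    + ((ContinuousLinearMap.fst ℝ ℝ ℝ).comp (ContinuousLinearMap.snd ℝ ℝ (ℝ × ℝ))).smulRight v2
    + ((ContinuousLinearMap.snd ℝ ℝ ℝ).comp (ContinuousLinearMap.snd ℝ ℝ (ℝ × ℝ))).smulRight n
  have hM : ∀ v, M v = v.1 • v1 + v.2.1 • v2 + v.2.2 • n := fun v => by simp [M]
  have hMi : Function.Injective M := by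
    rw [injective_iff_map_eq_zero]
    intro v hv
    rw [hM] at hv
    obtain ⟨h1, h2, h3⟩ := hbasis _ _ _ hv
    ext <;> simp [h1, h2, h3]
  let Me : (ℝ × ℝ × ℝ) ≃L[ℝ] ℝ × ℝ × ℝ := (LinearEquiv.ofInjectiveEndo M.toLinearMap hMi).toContinuousLinearEquiv
  have hMe : ∀ v, Me v = M v := fun v => rfl
  -- the derivative of the determinant
  let W : E4 := deriv (fun x : ℝ => fderiv ℝ f (x • n) n) 0
  have hcx : ContDiff ℝ ∞ (fun x : ℝ => x • n) := by fun_prop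
  have hfx : ∀ v, ContDiff ℝ ∞ (fun x : ℝ => fderiv ℝ f (x • n) v) := fun v => (hfv v).comp hcx
  have hWd : HasDerivAt (fun x : ℝ => fderiv ℝ f (x • n) n) W 0 :=
    ((hfx n).differentiable (by simp) 0).hasDerivAt
  have hdet : det4 (fderiv ℝ f 0 v1) (fderiv ℝ f 0 v2) W (ν 0) ≠ 0 := by
    intro hdet
    have h1 := det4_deriv_third (hfx v1) (hfx v2) (hν.comp hcx) hWd (by simp [hfn])
    simp only [zero_smul, Function.comp_apply, hdet] at h1
    let D : ℝ × ℝ × ℝ → ℝ := fun q => det4 (fderiv ℝ f q (1,0,0)) (fderiv ℝ f q (0,1,0))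
          (fderiv ℝ f q (0,0,1)) (ν q)
    have hD : ContDiff ℝ ∞ D := det4_contDiff (hfv _) (hfv _) (hfv _) hν
    have hκ := det3_ne v1 v2 n hbasis
    set κ := (v1.1 * (v2.2.1 * n.2.2 - v2.2.2 * n.2.1) - v1.2.1 * (v2.1 * n.2.2 - v2.2.2 * n.1)
    + v1.2.2 * (v2.1 * n.2.1 - v2.2.1 * n.1))
    have h2 : ∀ q, det4 (fderiv ℝ f q v1) (fderiv ℝ f q v2) (fderiv ℝ f q n) (ν q) = κ * D q := by
      intro q
      rw [lin3' (fderiv ℝ f q) v1, lin3' (fderiv ℝ f q) v2, lin3' (fderiv ℝ f q) n, det4_three]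
    have hxn : HasDerivAt (fun x : ℝ => x • n) n 0 := by
      simpa using (hasDerivAt_id (0:ℝ)).smul_const n
    have h3 : HasDerivAt (fun x : ℝ => D (x • n)) (fderiv ℝ D 0 n) 0 := by
      have e : HasFDerivAt D (fderiv ℝ D 0) ((0:ℝ) • n) := by
        rw [zero_smul]; exact (hD.differentiable (by simp) 0).hasFDerivAt
      exact e.comp_hasDerivAt (0:ℝ) hxn
    have h4 : fderiv ℝ D 0 n = 0 := by
      have e : (fun x : ℝ => det4 (fderiv ℝ f (x • n) v1) (fderiv ℝ f (x • n) v2) (fderiv ℝ f (x • n) n) (ν (x • n)))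
        = fun x => κ * D (x • n) := funext fun x => h2 _
      rw [e] at h1
      have := h1.unique (h3.const_mul κ)
      simpa [hκ] using this.symm
    apply hηlam
    have h5 : HasFDerivAt lam (c 0 • fderiv ℝ D 0 + D 0 • fderiv ℝ c 0) 0 :=
      HasFDerivAt.congr_of_eventuallyEq ((hc.differentiable (by simp) 0).hasFDerivAt.mul
        (hD.differentiable (by simp) 0).hasFDerivAt) hce
    rw [h5.fderiv]
    have hD0' : D 0 = 0 := hD0
    simp [h4, hD0']
  have hli : LinearIndependent ℝ ![fderiv ℝ f 0 v1, fderiv ℝ f 0 v2, W, ν 0] := by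
    have := (Matrix.linearIndependent_rows_iff_isUnit (A := Matrix.of ![fderiv ℝ f 0 v1, fderiv ℝ f 0 v2, W, ν 0])).2
      ((Matrix.isUnit_iff_isUnit_det _).2 (isUnit_iff_ne_zero.2 hdet))
    exact this
  let B := basisOfLinearIndependentOfCardEqFinrank hli (by simp)
  have hB : ∀ i, B i = ![fderiv ℝ f 0 v1, fderiv ℝ f 0 v2, W, ν 0] i := fun i => by
    simp [B]
  let L : E4 ≃L[ℝ] E4 := B.equivFunL
  have hL : ∀ i, L (![fderiv ℝ f 0 v1, fderiv ℝ f 0 v2, W, ν 0] i) = Pi.single i 1 := by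
    intro i
    rw [← hB]
    ext j
    simp [L, Module.Basis.equivFunL, Pi.single_apply, Finsupp.single_apply, eq_comm]
  have hL0 : L (fderiv ℝ f 0 v1) = ![1,0,0,0] := by
    refine (hL 0).trans ?_
    ext j; fin_cases j <;> simp
  have hL1 : L (fderiv ℝ f 0 v2) = ![0,1,0,0] := by
    refine (hL 1).trans ?_
    ext j; fin_cases j <;> simp
  have hL2 : L W = ![0,0,1,0] := by
    refine (hL 2).trans ?_
    ext j; fin_cases j <;> simp
  let F : ℝ × ℝ × ℝ → E4 := fun q => L (f (M q))
  have hF : ContDiff ℝ ∞ F := L.contDiff.comp (hf.comp M.contDiff)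
  have hFd : ∀ q v, fderiv ℝ F q v = L (fderiv ℝ f (M q) (M v)) := by
    intro q v
    have h1 : HasFDerivAt F ((L : E4 →L[ℝ] E4).comp ((fderiv ℝ f (M q)).comp M)) q :=
      L.hasFDerivAt.comp q ((hf.differentiable (by simp) (M q)).hasFDerivAt.comp q M.hasFDerivAt)
    rw [h1.fderiv]; rfl
  have m1 : M (1,0,0) = v1 := by simp [hM]
  have m2 : M (0,1,0) = v2 := by simp [hM]
  have m3 : M (0,0,1) = n := by simp [hM]
  have hMt : Tendsto M (𝓝 0) (𝓝 0) := M.continuous.tendsto' _ _ (map_zero M)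
  have hηne : ∀ᶠ q in 𝓝 (0 : ℝ × ℝ × ℝ), η q ≠ 0 :=
    hη.continuous.continuousAt.eventually_ne hn0
  have hF0 : F 0 = 0 := by simp [F, hf0]
  obtain ⟨b, hb, hbe⟩ := normal_form_A2 F (fun q => lam (M q)) hF (hlam.comp M.contDiff)
    hF0 (by simp [hlam0]) (by rw [hFd, map_zero, m1, hL0]) (by rw [hFd, map_zero, m2, hL1])
    (by rw [hFd, map_zero, m3, hfn, map_zero])
    (by
      have e : (fun x : ℝ => fderiv ℝ F (0,0,x) (0,0,1) 2) = fun x : ℝ => L (fderiv ℝ f (x • n) n) 2 := by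
        ext x
        rw [hFd, m3, hM]
        simp
      have h1 : HasDerivAt (fun x : ℝ => L (fderiv ℝ f (x • n) n)) (L W) 0 :=
        L.hasFDerivAt.comp_hasDerivAt (0:ℝ) hWd
      have h2 := hasDerivAt_pi.1 h1 2
      rw [e, h2.deriv, hL2]
      simp)
    (by
      have h1 : HasFDerivAt (fun q => lam (M q)) ((fderiv ℝ lam (M 0)).comp M) 0 :=
        (hlam.differentiable (by simp) (M 0)).hasFDerivAt.comp 0 M.hasFDerivAt
      rw [h1.fderiv]
      simp only [map_zero, ContinuousLinearMap.comp_apply, m3]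
      exact hηlam)
    (by
      filter_upwards [hMt.eventually hnull, hMt.eventually hηne] with q h1 h2 h3
      refine ⟨Me.symm (η (M q)), by simpa using h2, ?_⟩
      rw [hFd, ← hMe (Me.symm _), Me.apply_symm_apply]
      have : η (M q) ∈ LinearMap.ker (fderiv ℝ f (M q)).toLinearMap := by
        rw [h1 h3]; exact Submodule.mem_span_singleton_self _
      have h4 : fderiv ℝ f (M q) (η (M q)) = 0 := this
      rw [h4, map_zero])
  refine ⟨b, hb, AEquivAt.trans' ?_ hbe⟩
  refine ⟨Me.symm, L, ⟨Me.symm.contDiff.contDiffAt, ?_⟩, ⟨L.contDiff.contDiffAt, ?_⟩, map_zero _, ?_, ?_⟩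
  · rw [Me.symm.fderiv]; exact Me.symm.bijective
  · rw [L.fderiv]; exact L.bijective
  · rw [hf0, hF0, map_zero]
  · refine Eventually.of_forall fun q => ?_
    simp only [F]
    rw [← hMe, Me.apply_symm_apply]
end

section
open scoped Topology ContDiff
open Filter

theorem dot4_eq (u v : E4) : dot4 u v = u 0 * v 0 + u 1 * v 1 + u 2 * v 2 + u 3 * v 3 := by
  simp [dot4, Fin.sum_univ_four]

theorem dot4_self_ne {u : E4} (h : u ≠ 0) : dot4 u u ≠ 0 := by
  intro h0
  apply h
  rw [dot4_eq] at h0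
  have a0 := mul_self_nonneg (u 0)
  have a1 := mul_self_nonneg (u 1)
  have a2 := mul_self_nonneg (u 2)
  have a3 := mul_self_nonneg (u 3)
  have e0 : u 0 = 0 := mul_self_eq_zero.1 (by linarith)
  have e1 : u 1 = 0 := mul_self_eq_zero.1 (by linarith)
  have e2 : u 2 = 0 := mul_self_eq_zero.1 (by linarith)
  have e3 : u 3 = 0 := mul_self_eq_zero.1 (by linarith)
  ext i; fin_cases i <;> simp [e0, e1, e2, e3]

theorem eq_zero_of_dots {u v w x y : E4} (h : det4 u v w x ≠ 0) (h1 : dot4 u y = 0) (h2 : dot4 v y = 0)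
    (h3 : dot4 w y = 0) (h4 : dot4 x y = 0) : y = 0 := by
  by_contra hy
  apply h
  unfold det4
  rw [← Matrix.exists_mulVec_eq_zero_iff]
  refine ⟨y, hy, ?_⟩
  ext i
  fin_cases i
  · exact h1
  · exact h2
  · exact h3
  · exact h4

theorem dot4_contDiffAt {E : Type*} [NormedAddCommGroup E] [NormedSpace ℝ E] {n : WithTop ℕ∞}
    {a b : E → E4} {p : E} (ha : ContDiffAt ℝ n a p) (hb : ContDiffAt ℝ n b p) :
    ContDiffAt ℝ n (fun x => dot4 (a x) (b x)) p := by
  simp only [dot4_eq]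
  rw [contDiffAt_pi] at ha hb
  fun_prop

theorem det4_contDiffAt {E : Type*} [NormedAddCommGroup E] [NormedSpace ℝ E] {n : WithTop ℕ∞}
    {a b c d : E → E4} {p : E}
    (ha : ContDiffAt ℝ n a p) (hb : ContDiffAt ℝ n b p) (hc : ContDiffAt ℝ n c p)
    (hd : ContDiffAt ℝ n d p) :
    ContDiffAt ℝ n (fun x => det4 (a x) (b x) (c x) (d x)) p := by
  simp only [det4_expand]
  rw [contDiffAt_pi] at ha hb hc hd
  fun_prop

theorem normal_parallel (f ν : ℝ × ℝ × ℝ → E4)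
    (lam : ℝ × ℝ × ℝ → ℝ) (n : ℝ × ℝ × ℝ)
    (hν : ContDiff ℝ ∞ ν)
    (hν0 : ∀ᶠ q in 𝓝 (0 : ℝ × ℝ × ℝ), ν q ≠ 0)
    (hnormal : ∀ᶠ q in 𝓝 (0 : ℝ × ℝ × ℝ),
      ∀ v : ℝ × ℝ × ℝ, dot4 (fderiv ℝ f q v) (ν q) = 0)
    (hlam : ContDiff ℝ ∞ lam)
    (hident : ∃ c : ℝ × ℝ × ℝ → ℝ, ContDiff ℝ ∞ c ∧
      (∀ᶠ q in 𝓝 (0 : ℝ × ℝ × ℝ), c q ≠ 0) ∧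
      ∀ᶠ q in 𝓝 (0 : ℝ × ℝ × ℝ), lam q =
        c q * det4 (fderiv ℝ f q (1,0,0)) (fderiv ℝ f q (0,1,0))
          (fderiv ℝ f q (0,0,1)) (ν q))
    (hηlam : fderiv ℝ lam 0 n ≠ 0)
    (N : ℝ × ℝ × ℝ → E4) (hN : ContDiffAt ℝ 1 N 0)
    (hNn : ∀ᶠ q in 𝓝 (0 : ℝ × ℝ × ℝ), ∀ v : ℝ × ℝ × ℝ, dot4 (fderiv ℝ f q v) (N q) = 0) :
    ∀ᶠ q in 𝓝 (0 : ℝ × ℝ × ℝ), N q = (dot4 (N q) (ν q) / dot4 (ν q) (ν q)) • ν q := by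
  obtain ⟨c, hc, hc0, hce⟩ := hident
  let w : ℝ × ℝ × ℝ → E4 := fun q => N q - (dot4 (N q) (ν q) / dot4 (ν q) (ν q)) • ν q
  have hgood : ∀ᶠ q in 𝓝 (0 : ℝ × ℝ × ℝ), lam q ≠ 0 → w q = 0 := by
    filter_upwards [hν0, hnormal, hNn, hce] with q h1 h2 h3 h4 h5
    have hdet : det4 (fderiv ℝ f q (1,0,0)) (fderiv ℝ f q (0,1,0)) (fderiv ℝ f q (0,0,1)) (ν q) ≠ 0 := by
      intro h; rw [h, mul_zero] at h4; exact h5 h4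
    have hsub : ∀ u, dot4 u (w q) = dot4 u (N q) - (dot4 (N q) (ν q) / dot4 (ν q) (ν q)) * dot4 u (ν q) := by
      intro u
      simp only [w, dot4_eq u, Pi.sub_apply, Pi.smul_apply, smul_eq_mul]
      ring
    refine eq_zero_of_dots hdet ?_ ?_ ?_ ?_
    · rw [hsub, h2, h3]; simp
    · rw [hsub, h2, h3]; simp
    · rw [hsub, h2, h3]; simp
    · rw [hsub, div_mul_cancel₀ _ (dot4_self_ne h1)]
      simp only [dot4_eq]; ring
  have hwc : ∀ᶠ q in 𝓝 (0 : ℝ × ℝ × ℝ), ContinuousAt w q := by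
    filter_upwards [hN.eventually (by simp), hν0] with q h1 h2
    have hq : ContDiffAt ℝ 1 ν q := (hν.of_le (by simp)).contDiffAt
    have : ContDiffAt ℝ 1 w q := h1.sub
      (((dot4_contDiffAt h1 hq).div (dot4_contDiffAt hq hq) (dot4_self_ne h2)).smul hq)
    exact this.continuousAt
  have hdl : ∀ᶠ q in 𝓝 (0 : ℝ × ℝ × ℝ), fderiv ℝ lam q n ≠ 0 := by
    have : Continuous (fun q => fderiv ℝ lam q n) :=
      (hlam.continuous_fderiv (by simp)).clm_apply continuous_const
    exact this.continuousAt.eventually_ne hηlam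
  filter_upwards [hgood.eventually_nhds, hwc, hdl] with q h1 h2 h3
  suffices h : w q = 0 from sub_eq_zero.1 h
  by_contra hw
  have h4 := h2.eventually_ne hw
  have h5 : lam =ᶠ[𝓝 q] fun _ => 0 := by
    filter_upwards [h1, h4] with x hx hx'
    by_contra h
    exact hx' (hx h)
  apply h3
  rw [h5.fderiv_eq]
  simp

/-- Normal of the model. -/
noncomputable def nug (b : ℝ × ℝ × ℝ → ℝ) : ℝ × ℝ × ℝ → E4 := fun q =>
  ![-(q.2.2^3 * fderiv ℝ b (q.1, q.2.1, q.2.2^2) (1,0,0)),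
    -(q.2.2^3 * fderiv ℝ b (q.1, q.2.1, q.2.2^2) (0,1,0)),
    q.2.2 * (-(3/2) * b (q.1, q.2.1, q.2.2^2) - q.2.2^2 * fderiv ℝ b (q.1, q.2.1, q.2.2^2) (0,0,1)), 1]

theorem nug_contDiff {b : ℝ × ℝ × ℝ → ℝ} (hb : ContDiff ℝ ∞ b) : ContDiff ℝ ∞ (nug b) := by
  have hfb : ContDiff ℝ ∞ (fderiv ℝ b) := hb.fderiv_right (by simp)
  have h : ∀ v, ContDiff ℝ ∞ (fun q : ℝ × ℝ × ℝ => fderiv ℝ b (q.1, q.2.1, q.2.2^2) v) := fun v =>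
    (hfb.comp (by fun_prop)).clm_apply contDiff_const
  have h1 := h (1,0,0)
  have h2 := h (0,1,0)
  have h3 := h (0,0,1)
  exact contDiff_vec4 (by fun_prop) (by fun_prop) (by fun_prop) contDiff_const

theorem gmod_contDiff {b : ℝ × ℝ × ℝ → ℝ} (hb : ContDiff ℝ ∞ b) : ContDiff ℝ ∞ (gmod b) :=
  contDiff_vec4 (by fun_prop) (by fun_prop) (by fun_prop) (by fun_prop)

theorem gmod_fderiv {b : ℝ × ℝ × ℝ → ℝ} (hb : ContDiff ℝ ∞ b) (q v : ℝ × ℝ × ℝ) :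
    fderiv ℝ (gmod b) q v = ![v.1, v.2.1, 2 * q.2.2 * v.2.2,
      3 * q.2.2^2 * v.2.2 * b (q.1, q.2.1, q.2.2^2)
      + q.2.2^3 * (v.1 * fderiv ℝ b (q.1, q.2.1, q.2.2^2) (1,0,0)
        + v.2.1 * fderiv ℝ b (q.1, q.2.1, q.2.2^2) (0,1,0)
        + 2 * q.2.2 * v.2.2 * fderiv ℝ b (q.1, q.2.1, q.2.2^2) (0,0,1))] := by
  have hz : HasFDerivAt (fun q : ℝ × ℝ × ℝ => q.2.2)
    ((ContinuousLinearMap.snd ℝ ℝ ℝ).comp (ContinuousLinearMap.snd ℝ ℝ (ℝ × ℝ))) q :=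
    ((ContinuousLinearMap.snd ℝ ℝ ℝ).comp (ContinuousLinearMap.snd ℝ ℝ (ℝ × ℝ))).hasFDerivAt
  have hs : HasFDerivAt (fun q : ℝ × ℝ × ℝ => q.2.1)
    ((ContinuousLinearMap.fst ℝ ℝ ℝ).comp (ContinuousLinearMap.snd ℝ ℝ (ℝ × ℝ))) q :=
    ((ContinuousLinearMap.fst ℝ ℝ ℝ).comp (ContinuousLinearMap.snd ℝ ℝ (ℝ × ℝ))).hasFDerivAt
  have ht : HasFDerivAt (fun q : ℝ × ℝ × ℝ => q.1) (ContinuousLinearMap.fst ℝ ℝ (ℝ × ℝ)) q := hasFDerivAt_fst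
  have hm := ht.prodMk (hs.prodMk (hz.pow 2))
  have hbm := HasFDerivAt.comp (g := b) q (hb.differentiable (by simp) (q.1, q.2.1, q.2.2^2)).hasFDerivAt hm
  have h := hasFDerivAt_vec4 ht hs (hz.pow 2) ((hz.pow 3).mul hbm)
  have h' : HasFDerivAt (gmod b) _ q := h
  rw [h'.fderiv]
  ext i
  fin_cases i
  · simp
  · simp
  · simp
  · simp
    rw [lin3]
    simp
    ring

theorem nug_normal {b : ℝ × ℝ × ℝ → ℝ} (hb : ContDiff ℝ ∞ b) (q v : ℝ × ℝ × ℝ) :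
    dot4 (fderiv ℝ (gmod b) q v) (nug b q) = 0 := by
  rw [gmod_fderiv hb, dot4_eq]
  simp [nug]
  ring

theorem nug_fderiv {b : ℝ × ℝ × ℝ → ℝ} (hb : ContDiff ℝ ∞ b) (q : ℝ × ℝ × ℝ) (hq : q.2.2 = 0) (k : ℝ) :
    fderiv ℝ (nug b) q (0,0,k) = ![0, 0, k * (-(3/2) * b (q.1, q.2.1, 0)), 0] := by
  have hfb : ContDiff ℝ ∞ (fderiv ℝ b) := hb.fderiv_right (by simp)
  have h : ∀ v, ContDiff ℝ ∞ (fun q : ℝ × ℝ × ℝ => fderiv ℝ b (q.1, q.2.1, q.2.2^2) v) := fun v =>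
    (hfb.comp (by fun_prop)).clm_apply contDiff_const
  have h1 := h (1,0,0)
  have h2 := h (0,1,0)
  have h3 := h (0,0,1)
  have hd1 := (h1.differentiable (by simp) q).hasFDerivAt
  have hd2 := (h2.differentiable (by simp) q).hasFDerivAt
  have hd3 : HasFDerivAt (fun q : ℝ × ℝ × ℝ => -(3/2) * b (q.1, q.2.1, q.2.2^2) - q.2.2^2 * fderiv ℝ b (q.1, q.2.1, q.2.2^2) (0,0,1)) _ q :=
    (ContDiff.differentiable (n := ∞) (by fun_prop) (by simp) q).hasFDerivAt
  have hz : HasFDerivAt (fun q : ℝ × ℝ × ℝ => q.2.2)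
    ((ContinuousLinearMap.snd ℝ ℝ ℝ).comp (ContinuousLinearMap.snd ℝ ℝ (ℝ × ℝ))) q :=
    ((ContinuousLinearMap.snd ℝ ℝ ℝ).comp (ContinuousLinearMap.snd ℝ ℝ (ℝ × ℝ))).hasFDerivAt
  have hh := hasFDerivAt_vec4 ((hz.pow 3).mul hd1).neg ((hz.pow 3).mul hd2).neg (hz.mul hd3)
    (hasFDerivAt_const (1:ℝ) q)
  have h' : HasFDerivAt (nug b) _ q := hh
  rw [h'.fderiv]
  ext i
  fin_cases i <;> simp [hq]
  ring
end

section
open scoped Topology ContDiff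
open Filter

theorem lin4 (L : E4 →L[ℝ] E4) (u : E4) : L u = ∑ i, u i • L (Pi.single i 1) := by
  conv_lhs => rw [show u = ∑ i, u i • (Pi.single i (1:ℝ) : E4) by
    ext j; simp [Finset.sum_apply, Pi.single_apply]]
  rw [map_sum]
  simp only [map_smul]

theorem dot4_fderiv {E : Type*} [NormedAddCommGroup E] [NormedSpace ℝ E] {a b : E → E4} {p : E}
    (ha : DifferentiableAt ℝ a p) (hb : DifferentiableAt ℝ b p) (v : E) :
    fderiv ℝ (fun x => dot4 (a x) (b x)) p v = dot4 (fderiv ℝ a p v) (b p) + dot4 (a p) (fderiv ℝ b p v) := by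
  have ha' := hasFDerivAt_pi'.1 ha.hasFDerivAt
  have hb' := hasFDerivAt_pi'.1 hb.hasFDerivAt
  have h : HasFDerivAt (fun x => dot4 (a x) (b x)) _ p :=
    HasFDerivAt.fun_sum (u := Finset.univ) fun i _ => (ha' i).mul (hb' i)
  rw [h.fderiv]
  simp only [dot4, Fin.sum_univ_four]
  simp
  ring

theorem pull_dot (L : E4 →L[ℝ] E4) (u w : E4) :
    dot4 u (fun i => dot4 (L (Pi.single i 1)) w) = dot4 (L u) w := by
  rw [lin4 L u, Fin.sum_univ_four]
  simp only [dot4_eq, Pi.add_apply, Pi.smul_apply, smul_eq_mul]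
  ring

theorem pull_coord (L : E4 →L[ℝ] E4) (u : E4) (j : Fin 4) :
    dot4 u (fun i => L (Pi.single i 1) j) = L u j := by
  rw [lin4 L u, Fin.sum_univ_four]
  simp only [dot4_eq, Pi.add_apply, Pi.smul_apply, smul_eq_mul]

theorem inv_key
    (f : ℝ × ℝ × ℝ → E4) (ν : ℝ × ℝ × ℝ → E4)
    (lam : ℝ × ℝ × ℝ → ℝ) (ξ₁ ξ₂ η : ℝ × ℝ × ℝ → ℝ × ℝ × ℝ)
    (hf : ContDiff ℝ ∞ f) (hf0 : f 0 = 0)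
    (hν : ContDiff ℝ ∞ ν)
    (hν0 : ∀ᶠ q in 𝓝 (0 : ℝ × ℝ × ℝ), ν q ≠ 0)
    (hnormal : ∀ᶠ q in 𝓝 (0 : ℝ × ℝ × ℝ),
      ∀ v : ℝ × ℝ × ℝ, dot4 (fderiv ℝ f q v) (ν q) = 0)
    (hlam : ContDiff ℝ ∞ lam)
    (hident : ∃ c : ℝ × ℝ × ℝ → ℝ, ContDiff ℝ ∞ c ∧
      (∀ᶠ q in 𝓝 (0 : ℝ × ℝ × ℝ), c q ≠ 0) ∧
      ∀ᶠ q in 𝓝 (0 : ℝ × ℝ × ℝ), lam q =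
        c q * det4 (fderiv ℝ f q (1,0,0)) (fderiv ℝ f q (0,1,0))
          (fderiv ℝ f q (0,0,1)) (ν q))
    (hlam0 : lam 0 = 0)
    (hη : ContDiff ℝ ∞ η)
    (hnull : ∀ᶠ q in 𝓝 (0 : ℝ × ℝ × ℝ), lam q = 0 →
      LinearMap.ker (fderiv ℝ f q).toLinearMap = Submodule.span ℝ {η q})
    (hηlam : fderiv ℝ lam 0 (η 0) ≠ 0)
    (hξ₁ : ContDiff ℝ ∞ ξ₁) (hξ₂ : ContDiff ℝ ∞ ξ₂)
    (hind : LinearIndependent ℝ ![ξ₁ 0, ξ₂ 0])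
    (htan₁ : fderiv ℝ lam 0 (ξ₁ 0) = 0)
    (htan₂ : fderiv ℝ lam 0 (ξ₂ 0) = 0)
    (b : ℝ × ℝ × ℝ → ℝ) (hb : ContDiff ℝ ∞ b)
    (φ : ℝ × ℝ × ℝ → ℝ × ℝ × ℝ) (Φ : E4 → E4)
    (hφ : IsDiffeoGermAt φ 0) (hΦ : IsDiffeoGermAt Φ 0) (hφ0 : φ 0 = 0)
    (he : ∀ᶠ q in 𝓝 (0 : ℝ × ℝ × ℝ), Φ (f q) = gmod b (φ q)) :
    ∃ ρ V : ℝ × ℝ × ℝ → ℝ, ContDiffAt ℝ 1 ρ 0 ∧ ContDiffAt ℝ 1 V 0 ∧ ρ 0 ≠ 0 ∧ V 0 ≠ 0 ∧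
      (∀ c₁ c₂ : ℝ, (c₁ • fderiv ℝ φ 0 (ξ₁ 0) + c₂ • fderiv ℝ φ 0 (ξ₂ 0)).1 = 0 →
        (c₁ • fderiv ℝ φ 0 (ξ₁ 0) + c₂ • fderiv ℝ φ 0 (ξ₂ 0)).2.1 = 0 → c₁ = 0 ∧ c₂ = 0) ∧
      ∀ᶠ q in 𝓝 (0 : ℝ × ℝ × ℝ), lam q = 0 →
        (ρ q)^2 * det4 (fderiv ℝ f q (ξ₁ q)) (fderiv ℝ f q (ξ₂ q)) (ν q) (fderiv ℝ ν q (η q))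
          = V q * b ((φ q).1, (φ q).2.1, 0) := by
  have hfd : ContDiff ℝ ∞ (fderiv ℝ f) := hf.fderiv_right (by simp)
  have hft : Tendsto f (𝓝 0) (𝓝 0) := by
    have := hf.continuous.continuousAt (x := 0) |>.tendsto
    rwa [hf0] at this
  have le3 : (3 : WithTop ℕ∞) ≤ ∞ := WithTop.coe_le_coe.2 (le_top : (3:ℕ∞) ≤ ⊤)
  have hφ3 : ContDiffAt ℝ 3 φ 0 := hφ.1.of_le le3
  have hΦ3 : ContDiffAt ℝ 3 Φ 0 := hΦ.1.of_le le3
  have hφe : ∀ᶠ q in 𝓝 (0 : ℝ × ℝ × ℝ), ContDiffAt ℝ 3 φ q := hφ3.eventually (by simp)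
  have hΦe : ∀ᶠ q in 𝓝 (0 : ℝ × ℝ × ℝ), ContDiffAt ℝ 3 Φ (f q) := hft.eventually (hΦ3.eventually (by simp))
  let A : ℝ × ℝ × ℝ → (E4 →L[ℝ] E4) := fun q => fderiv ℝ Φ (f q)
  let B : ℝ × ℝ × ℝ → (ℝ × ℝ × ℝ →L[ℝ] ℝ × ℝ × ℝ) := fun q => fderiv ℝ φ q
  have hA0 : A 0 = fderiv ℝ Φ 0 := by simp [A, hf0]
  have hAc : ∀ q, ContDiffAt ℝ 3 Φ (f q) → ContDiffAt ℝ 2 A q := fun q h =>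
    ContDiffAt.comp q (h.fderiv_right (m := 2) (by norm_num)) (hf.of_le (WithTop.coe_le_coe.2 (le_top : (2:ℕ∞) ≤ ⊤))).contDiffAt
  have hBc : ∀ q, ContDiffAt ℝ 3 φ q → ContDiffAt ℝ 2 B q := fun q h =>
    h.fderiv_right (m := 2) (by norm_num)
  have hΦ30 : ContDiffAt ℝ 3 Φ (f 0) := by rw [hf0]; exact hΦ3
  -- chain rule
  have hchain : ∀ᶠ q in 𝓝 (0 : ℝ × ℝ × ℝ), ∀ v, A q (fderiv ℝ f q v) = fderiv ℝ (gmod b) (φ q) (B q v) := by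
    filter_upwards [hφe, hΦe, he.eventually_nhds] with q h1 h2 h3 v
    have e1 := (h2.differentiableAt (by simp)).hasFDerivAt.comp q (hf.differentiable (by simp) q).hasFDerivAt
    have e2 := ((gmod_contDiff hb).differentiable (by simp) (φ q)).hasFDerivAt.comp q
      (h1.differentiableAt (by simp)).hasFDerivAt
    have e3 := e1.unique (e2.congr_of_eventuallyEq h3)
    exact DFunLike.congr_fun e3 v
  -- kernel direction
  have hn0 : η 0 ≠ 0 := by intro h; rw [h] at hηlam; simp at hηlam
  have hBη0 : B 0 (η 0) ≠ 0 := by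
    intro h
    exact hn0 (hφ.2.1 (by rw [map_zero]; exact h))
  have le2 : (2 : WithTop ℕ∞) ≤ ∞ := WithTop.coe_le_coe.2 (le_top : (2:ℕ∞) ≤ ⊤)
  have hBη : ContDiffAt ℝ 2 (fun q => B q (η q)) 0 := (hBc 0 hφ3).clm_apply (hη.of_le le2).contDiffAt
  have hBηne : ∀ᶠ q in 𝓝 (0 : ℝ × ℝ × ℝ), B q (η q) ≠ 0 := hBη.continuousAt.eventually_ne hBη0
  have hfη : ∀ᶠ q in 𝓝 (0 : ℝ × ℝ × ℝ), lam q = 0 → fderiv ℝ f q (η q) = 0 := by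
    filter_upwards [hnull] with q h1 h2
    have : η q ∈ LinearMap.ker (fderiv ℝ f q).toLinearMap := by
      rw [h1 h2]; exact Submodule.mem_span_singleton_self _
    exact this
  have hkd : ∀ᶠ q in 𝓝 (0 : ℝ × ℝ × ℝ), lam q = 0 → (φ q).2.2 = 0 ∧ (B q (η q)).2.2 ≠ 0 ∧
      B q (η q) = (0, 0, (B q (η q)).2.2) := by
    filter_upwards [hfη, hBηne, hchain] with q h1 h2 h3 h4
    have h5 := h3 (η q)
    rw [h1 h4, map_zero, gmod_fderiv hb] at h5
    have e0 := congrFun h5 0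
    have e1 := congrFun h5 1
    have e2 := congrFun h5 2
    simp at e0 e1 e2
    have e3 : (B q (η q)).2.2 ≠ 0 := by
      intro h
      apply h2
      ext <;> simp [← e0, ← e1, h]
    exact ⟨e2.resolve_right e3, e3, by ext <;> simp [← e0, ← e1]⟩
  obtain ⟨-, hk0, hBn⟩ := hkd.self_of_nhds hlam0
  -- independence
  have hζ : ∀ c₁ c₂ : ℝ, (c₁ • fderiv ℝ φ 0 (ξ₁ 0) + c₂ • fderiv ℝ φ 0 (ξ₂ 0)).1 = 0 →
        (c₁ • fderiv ℝ φ 0 (ξ₁ 0) + c₂ • fderiv ℝ φ 0 (ξ₂ 0)).2.1 = 0 → c₁ = 0 ∧ c₂ = 0 := by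
    intro c₁ c₂ h1 h2
    set x := (c₁ • fderiv ℝ φ 0 (ξ₁ 0) + c₂ • fderiv ℝ φ 0 (ξ₂ 0)).2.2 with hx
    set k := (B 0 (η 0)).2.2 with hk
    have h3 : fderiv ℝ φ 0 (c₁ • ξ₁ 0 + c₂ • ξ₂ 0) = fderiv ℝ φ 0 ((x/k) • η 0) := by
      rw [map_smul]
      change _ = (x/k) • B 0 (η 0)
      rw [hBn, map_add, map_smul, map_smul]
      ext
      · rw [h1]; simp
      · rw [h2]; simp
      · rw [← hx]; simp [hk0]
    have h4 := hφ.2.1 h3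
    have h5 := congrArg (fderiv ℝ lam 0) h4
    simp only [map_add, map_smul, htan₁, htan₂, smul_eq_mul, mul_zero, add_zero] at h5
    have h6 : x / k = 0 := by
      rcases mul_eq_zero.1 h5.symm with h | h
      · exact h
      · exact absurd h hηlam
    rw [h6, zero_smul] at h4
    exact LinearIndependent.pair_iff.1 hind c₁ c₂ h4
  -- pulled back normal
  let N : ℝ × ℝ × ℝ → E4 := fun q i => dot4 (A q (Pi.single i 1)) (nug b (φ q))
  have hNc : ∀ q, ContDiffAt ℝ 3 φ q → ContDiffAt ℝ 3 Φ (f q) → ContDiffAt ℝ 2 N q := by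
    intro q h1 h2
    rw [contDiffAt_pi]
    intro i
    refine dot4_contDiffAt ((hAc q h2).clm_apply contDiffAt_const) ?_
    exact ((nug_contDiff hb).of_le le2).contDiffAt.comp q (h1.of_le (by norm_num))
  have hNn : ∀ᶠ q in 𝓝 (0 : ℝ × ℝ × ℝ), ∀ v : ℝ × ℝ × ℝ, dot4 (fderiv ℝ f q v) (N q) = 0 := by
    filter_upwards [hchain] with q h1 v
    rw [pull_dot, h1, nug_normal hb]
  have hpar := normal_parallel f ν lam (η 0) hν hν0 hnormal hlam hident hηlam N
    ((hNc 0 hφ3 hΦ30).of_le (by norm_num)) hNn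
  let ρ : ℝ × ℝ × ℝ → ℝ := fun q => dot4 (N q) (ν q) / dot4 (ν q) (ν q)
  have hρc : ∀ q, ContDiffAt ℝ 3 φ q → ContDiffAt ℝ 3 Φ (f q) → ν q ≠ 0 → ContDiffAt ℝ 2 ρ q := by
    intro q h1 h2 h3
    have hq : ContDiffAt ℝ 2 ν q := (hν.of_le le2).contDiffAt
    exact (dot4_contDiffAt (hNc q h1 h2) hq).div (dot4_contDiffAt hq hq) (dot4_self_ne h3)
  have hnug0 : ∀ p : ℝ × ℝ × ℝ, p.2.2 = 0 → nug b p = ![0,0,0,1] := by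
    intro p hp
    ext i; fin_cases i <;> simp [nug, hp]
  have hsurjA : Function.Surjective (A 0) := by rw [hA0]; exact hΦ.2.2
  have hρ0 : ρ 0 ≠ 0 := by
    intro h
    have h1 : N 0 = 0 := by
      have := hpar.self_of_nhds
      change N 0 = ρ 0 • ν 0 at this
      rw [this, h, zero_smul]
    obtain ⟨u, hu⟩ := hsurjA ![0,0,0,1]
    have h2 := pull_dot (A 0) u (nug b (φ 0))
    change dot4 u (N 0) = _ at h2
    rw [h1, hu, hφ0, hnug0 0 rfl] at h2
    simp [dot4_eq] at h2
  let P : Fin 4 → ℝ × ℝ × ℝ → E4 := fun j q i => A q (Pi.single i 1) j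
  have hPc : ∀ j, ContDiffAt ℝ 2 (P j) 0 := by
    intro j
    rw [contDiffAt_pi]
    intro i
    exact (contDiffAt_pi.1 ((hAc 0 hΦ30).clm_apply contDiffAt_const)) j
  let V : ℝ × ℝ × ℝ → ℝ := fun q => (B q (η q)).2.2 * (-(3/2)) *
    det4 (fderiv ℝ f q (ξ₁ q)) (fderiv ℝ f q (ξ₂ q)) (P 3 q) (P 2 q)
  have hVc : ContDiffAt ℝ 2 V 0 := by
    refine ContDiffAt.mul (hBη.snd.snd.mul contDiffAt_const) (det4_contDiffAt ?_ ?_ (hPc 3) (hPc 2))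
    · exact ((hfd.clm_apply hξ₁).of_le le2).contDiffAt
    · exact ((hfd.clm_apply hξ₂).of_le le2).contDiffAt
  have hV0 : V 0 ≠ 0 := by
    refine mul_ne_zero (mul_ne_zero hk0 (by norm_num)) (det4_ne_zero_of _ _ _ _ ?_)
    intro c hc
    have hch := hchain.self_of_nhds
    have ha1 : A 0 (fderiv ℝ f 0 (ξ₁ 0)) = ![(fderiv ℝ φ 0 (ξ₁ 0)).1, (fderiv ℝ φ 0 (ξ₁ 0)).2.1, 0, 0] := by
      rw [hch, gmod_fderiv hb, hφ0]
      ext i; fin_cases i <;> simp [B]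
    have ha2 : A 0 (fderiv ℝ f 0 (ξ₂ 0)) = ![(fderiv ℝ φ 0 (ξ₂ 0)).1, (fderiv ℝ φ 0 (ξ₂ 0)).2.1, 0, 0] := by
      rw [hch, gmod_fderiv hb, hφ0]
      ext i; fin_cases i <;> simp [B]
    set a1 := fderiv ℝ f 0 (ξ₁ 0)
    set a2 := fderiv ℝ f 0 (ξ₂ 0)
    have hPd : ∀ j u, dot4 u (P j 0) = A 0 u j := fun j u => pull_coord (A 0) u j
    set y := c 2 • P 3 0 + c 3 • P 2 0 with hy
    have hyd : ∀ u, dot4 u y = c 2 * A 0 u 3 + c 3 * A 0 u 2 := by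
      intro u
      rw [← hPd, ← hPd]
      simp only [hy, dot4_eq, Pi.add_apply, Pi.smul_apply, smul_eq_mul]
      ring
    have hy2 : y = -(c 0 • a1 + c 1 • a2) := by
      rw [eq_neg_iff_add_eq_zero, ← hc, hy]; abel
    have hy0 : y = 0 := by
      by_contra hne
      apply dot4_self_ne hne
      have h1 : dot4 y y = -(c 0 * dot4 a1 y + c 1 * dot4 a2 y) := by
        have : dot4 y y = dot4 (-(c 0 • a1 + c 1 • a2)) y := by rw [← hy2]
        rw [this]
        simp only [dot4_eq, Pi.neg_apply, Pi.add_apply, Pi.smul_apply, smul_eq_mul]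
        ring
      rw [h1, hyd, hyd, ha1, ha2]
      simp
    have h01 : c 0 = 0 ∧ c 1 = 0 := by
      have h1 : c 0 • a1 + c 1 • a2 = 0 := by rw [hy0] at hy2; exact neg_eq_zero.1 hy2.symm
      have h2 := congrArg (A 0) h1
      rw [map_add, map_smul, map_smul, ha1, ha2, map_zero] at h2
      have e0 := congrFun h2 0
      have e1 := congrFun h2 1
      simp at e0 e1
      exact hζ (c 0) (c 1) (by simpa using e0) (by simpa using e1)
    have h2 : c 2 = 0 := by
      obtain ⟨u, hu⟩ := hsurjA ![0,0,0,1]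
      have := hyd u
      rw [hy0, hu] at this
      simpa [dot4_eq] using this.symm
    have h3 : c 3 = 0 := by
      obtain ⟨u, hu⟩ := hsurjA ![0,0,1,0]
      have := hyd u
      rw [hy0, hu] at this
      simpa [dot4_eq] using this.symm
    ext i; fin_cases i <;> simp [h01.1, h01.2, h2, h3]
  refine ⟨ρ, V, (hρc 0 hφ3 hΦ30 hν0.self_of_nhds).of_le (by norm_num), hVc.of_le (by norm_num), hρ0, hV0, hζ, ?_⟩
  filter_upwards [hφe, hΦe, hν0, hpar.eventually_nhds, hkd, hfη] with q h1 h2 h3 h4 h5 h6 hl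
  obtain ⟨hz, hk, hBq⟩ := h5 hl
  have hfq := h6 hl
  set k := (B q (η q)).2.2 with hkdef
  have hNq : N q = ρ q • ν q := h4.self_of_nhds
  have hN3 : N q = P 3 q := by
    ext i
    simp only [N, P, hnug0 _ hz, dot4_eq]
    simp
  have hAd : DifferentiableAt ℝ A q := (hAc q h2).differentiableAt (by simp)
  have hAη : fderiv ℝ A q (η q) = 0 := by
    have e1 : HasFDerivAt A ((fderiv ℝ (fderiv ℝ Φ) (f q)).comp (fderiv ℝ f q)) q :=
      HasFDerivAt.comp q (((h2.fderiv_right (m := 2) (by norm_num)).differentiableAt (by simp)).hasFDerivAt)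
        (hf.differentiable (by simp) q).hasFDerivAt
    rw [e1.fderiv]
    simp [hfq]
  have hφq := (h1.differentiableAt (by simp)).hasFDerivAt
  have hnd := (((nug_contDiff hb).differentiable (by simp) (φ q)).hasFDerivAt.comp q hφq)
  have hdN : fderiv ℝ N q (η q) = (k * (-(3/2) * b ((φ q).1, (φ q).2.1, 0))) • P 2 q := by
    have hNd : DifferentiableAt ℝ N q := (hNc q h1 h2).differentiableAt (by simp)
    ext i
    have e1 : fderiv ℝ N q (η q) i = fderiv ℝ (fun q => N q i) q (η q) := by
      rw [((hasFDerivAt_pi'.1 hNd.hasFDerivAt) i).fderiv]; rfl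
    have hAi : HasFDerivAt (fun q => A q (Pi.single i 1)) _ q :=
      hAd.hasFDerivAt.clm_apply (hasFDerivAt_const (Pi.single i 1 : E4) q)
    have e2 := dot4_fderiv hAi.differentiableAt hnd.differentiableAt (η q)
    rw [e1]
    refine e2.trans ?_
    rw [hAi.fderiv, hnd.fderiv]
    have e3 : fderiv ℝ φ q (η q) = (0,0,k) := hBq
    simp only [ContinuousLinearMap.comp_apply, e3, nug_fderiv hb _ hz]
    simp [hAη, dot4_eq, P]
    ring
  have hdN2 : fderiv ℝ N q (η q) = ρ q • fderiv ℝ ν q (η q) + (fderiv ℝ ρ q (η q)) • ν q := by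
    have hρd : DifferentiableAt ℝ ρ q := (hρc q h1 h2 h3).differentiableAt (by simp)
    have e1 := hρd.hasFDerivAt.smul (hν.differentiable (by simp) q).hasFDerivAt
    have e2 := e1.congr_of_eventuallyEq h4
    have e3 : HasFDerivAt N _ q := e2
    rw [e3.fderiv]
    simp
  have d1 : det4 (fderiv ℝ f q (ξ₁ q)) (fderiv ℝ f q (ξ₂ q)) (N q) (fderiv ℝ N q (η q))
      = (ρ q)^2 * det4 (fderiv ℝ f q (ξ₁ q)) (fderiv ℝ f q (ξ₂ q)) (ν q) (fderiv ℝ ν q (η q)) := by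
    rw [hdN2, hNq]
    simp only [det4_expand, Pi.add_apply, Pi.smul_apply, smul_eq_mul]
    ring
  rw [← d1, hdN, hN3]
  simp only [V, det4_expand, Pi.smul_apply, smul_eq_mul]
  ring
end

section
open scoped Topology ContDiff
open Filter

theorem deriv_zero_on_level (lam H : ℝ × ℝ × ℝ → ℝ) (hlam : ContDiffAt ℝ 1 lam 0) (hH : ContDiffAt ℝ 1 H 0)
    (hlam0 : lam 0 = 0) (hH0 : H 0 = 0) (w : ℝ × ℝ × ℝ) (hw : fderiv ℝ lam 0 w ≠ 0)
    (h : ∀ᶠ q in 𝓝 (0 : ℝ × ℝ × ℝ), lam q = 0 → H q = 0) (v : ℝ × ℝ × ℝ)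
    (hv : fderiv ℝ lam 0 v = 0) : fderiv ℝ H 0 v = 0 := by
  have hext : IsLocalExtrOn H {x | lam x = lam 0} 0 := by
    left
    rw [IsMinFilter]
    rw [eventually_nhdsWithin_iff]
    filter_upwards [h] with q hq hq1
    rw [hH0, hq (by rw [← hlam0]; exact hq1)]
  obtain ⟨a, c, hac, hc⟩ := hext.exists_multipliers_of_hasStrictFDerivAt_1d
    (hlam.hasStrictFDerivAt (by simp)) (hH.hasStrictFDerivAt (by simp))
  have h1 := DFunLike.congr_fun hc w
  have h2 := DFunLike.congr_fun hc v
  simp at h1 h2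
  rw [hv] at h2
  have hc0 : c ≠ 0 := by
    intro hc0
    rw [hc0] at h1
    simp [hw] at h1
    exact hac (by rw [h1, hc0]; rfl)
  simpa [hc0] using h2

theorem inv_final (lam ψ ρ V b : ℝ × ℝ × ℝ → ℝ) (φ : ℝ × ℝ × ℝ → ℝ × ℝ × ℝ) (v₁ v₂ w : ℝ × ℝ × ℝ)
    (hlam : ContDiffAt ℝ 1 lam 0) (hψ : ContDiffAt ℝ 1 ψ 0) (hρ : ContDiffAt ℝ 1 ρ 0)
    (hV : ContDiffAt ℝ 1 V 0) (hb : ContDiffAt ℝ 1 b 0) (hφ : ContDiffAt ℝ 1 φ 0)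
    (hρ0 : ρ 0 ≠ 0) (hV0 : V 0 ≠ 0) (hlam0 : lam 0 = 0) (hφ0 : φ 0 = 0)
    (hw : fderiv ℝ lam 0 w ≠ 0) (hv₁ : fderiv ℝ lam 0 v₁ = 0) (hv₂ : fderiv ℝ lam 0 v₂ = 0)
    (hc : ∀ c₁ c₂ : ℝ, (c₁ • fderiv ℝ φ 0 v₁ + c₂ • fderiv ℝ φ 0 v₂).1 = 0 →
        (c₁ • fderiv ℝ φ 0 v₁ + c₂ • fderiv ℝ φ 0 v₂).2.1 = 0 → c₁ = 0 ∧ c₂ = 0)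
    (h : ∀ᶠ q in 𝓝 (0 : ℝ × ℝ × ℝ), lam q = 0 →
        (ρ q)^2 * ψ q = V q * b ((φ q).1, (φ q).2.1, 0)) :
    (ψ 0 = 0 ∧ (fderiv ℝ ψ 0 v₁, fderiv ℝ ψ 0 v₂) ≠ (0, 0)) ↔
      (b 0 = 0 ∧ (fderiv ℝ b 0 (1,0,0) ≠ 0 ∨ fderiv ℝ b 0 (0,1,0) ≠ 0)) := by
  have e0 := h.self_of_nhds hlam0
  have p0 : (((φ 0).1, (φ 0).2.1, 0) : ℝ × ℝ × ℝ) = 0 := by rw [hφ0]; rfl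
  rw [p0] at e0
  have hz : ψ 0 = 0 ↔ b 0 = 0 := by
    constructor
    · intro hh; rw [hh] at e0; simpa [hV0] using e0.symm
    · intro hh; rw [hh] at e0; simpa [hρ0] using e0
  rw [← hz]
  apply and_congr_right
  intro hψ0
  have hb0 := hz.1 hψ0
  let P : ℝ × ℝ × ℝ → ℝ × ℝ × ℝ := fun q => ((φ q).1, (φ q).2.1, 0)
  have hP : HasFDerivAt P (((ContinuousLinearMap.fst ℝ ℝ (ℝ × ℝ)).comp (fderiv ℝ φ 0)).prod
      ((((ContinuousLinearMap.fst ℝ ℝ ℝ).comp (ContinuousLinearMap.snd ℝ ℝ (ℝ × ℝ))).comp (fderiv ℝ φ 0)).prod 0)) 0 := by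
    have hd := (hφ.differentiableAt (by simp)).hasFDerivAt
    exact hd.fst.prodMk (hd.snd.fst.prodMk (hasFDerivAt_const _ _))
  have hPc : ContDiffAt ℝ 1 P 0 := hφ.fst.prodMk (hφ.snd.fst.prodMk contDiffAt_const)
  have hP0 : P 0 = 0 := p0
  have hbP : ContDiffAt ℝ 1 (fun q => b (P q)) 0 := ContDiffAt.comp 0 (by rw [hP0]; exact hb) hPc
  have hbd : HasFDerivAt b (fderiv ℝ b 0) (P 0) := by
    rw [hP0]; exact (hb.differentiableAt (by simp)).hasFDerivAt
  have key : ∀ v, fderiv ℝ lam 0 v = 0 → (ρ 0)^2 * fderiv ℝ ψ 0 v =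
      V 0 * ((fderiv ℝ φ 0 v).1 * fderiv ℝ b 0 (1,0,0) + (fderiv ℝ φ 0 v).2.1 * fderiv ℝ b 0 (0,1,0)) := by
    intro v hv
    have hH := deriv_zero_on_level lam (fun q => (ρ q)^2 * ψ q - V q * b (P q)) hlam
      (((hρ.pow 2).mul hψ).sub (hV.mul hbP)) hlam0 (by simp [hψ0, hP0, hb0]) w hw
      (by filter_upwards [h] with q hq hq1
          have := hq hq1
          simp only [P]; linarith) v hv
    have d1 := ((hρ.pow 2).differentiableAt (by simp)).hasFDerivAt.mul (hψ.differentiableAt (by simp)).hasFDerivAt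
    have d2 := (hV.differentiableAt (by simp)).hasFDerivAt.mul (hbd.comp 0 hP)
    have d3 := (d1.sub d2).fderiv
    have d4 : fderiv ℝ (fun q => (ρ q)^2 * ψ q - V q * b (P q)) 0 v = _ := DFunLike.congr_fun d3 v
    rw [hH] at d4
    simp [hψ0, hP0, hb0] at d4
    rw [lin3 (fderiv ℝ b 0)] at d4
    simp at d4
    linarith
  have k1 := key v₁ hv₁
  have k2 := key v₂ hv₂
  set z₁ := fderiv ℝ φ 0 v₁
  set z₂ := fderiv ℝ φ 0 v₂
  have hD : z₁.1 * z₂.2.1 - z₁.2.1 * z₂.1 ≠ 0 := by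
    intro hD
    have a1 := hc z₂.1 (-z₁.1) (by simp; ring) (by simp; linarith)
    have a2 := hc z₂.2.1 (-z₁.2.1) (by simp; linarith) (by simp; ring)
    have a3 := hc 1 0 (by simp; linarith [a1.2]) (by simp; linarith [a2.2])
    exact one_ne_zero a3.1
  have hρ2 : (ρ 0)^2 ≠ 0 := pow_ne_zero 2 hρ0
  generalize fderiv ℝ b 0 (1,0,0) = bt at *
  generalize fderiv ℝ b 0 (0,1,0) = bs at *
  generalize fderiv ℝ ψ 0 v₁ = y1 at *
  generalize fderiv ℝ ψ 0 v₂ = y2 at *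
  rw [Ne, Prod.mk.injEq]
  rw [← not_and_or]
  apply not_congr
  constructor
  · rintro ⟨r1, r2⟩
    rw [r1, mul_zero] at k1
    rw [r2, mul_zero] at k2
    have m1 := (mul_eq_zero.1 k1.symm).resolve_left hV0
    have m2 := (mul_eq_zero.1 k2.symm).resolve_left hV0
    constructor
    · apply (mul_eq_zero.1 (?_ : (z₁.1 * z₂.2.1 - z₁.2.1 * z₂.1) * bt = 0)).resolve_left hD
      linear_combination z₂.2.1 * m1 - z₁.2.1 * m2
    · apply (mul_eq_zero.1 (?_ : (z₁.1 * z₂.2.1 - z₁.2.1 * z₂.1) * bs = 0)).resolve_left hD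
      linear_combination z₁.1 * m2 - z₂.1 * m1
  · rintro ⟨r1, r2⟩
    rw [r1, r2] at k1 k2
    simp [hρ0] at k1 k2
    exact ⟨k1, k2⟩
end

/-- Criterion (adapted-triple version) for the cuspidal cross cap × interval: with an
adapted triple `(ξ₁,ξ₂,η)` and `ψ̄ = det(ξ₁f, ξ₂f, ν, ην)`, the frontal `f` is a
cuspidal cross cap × interval at `0` iff `ψ̄(0) = 0` and `(ξ₁ψ̄(0), ξ₂ψ̄(0)) ≠ (0,0)`. -/
theorem stmt11
    (f : ℝ × ℝ × ℝ → E4) (ν : ℝ × ℝ × ℝ → E4)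
    (lam : ℝ × ℝ × ℝ → ℝ) (ξ₁ ξ₂ η : ℝ × ℝ × ℝ → ℝ × ℝ × ℝ)
    (ψb : ℝ × ℝ × ℝ → ℝ)
    (hf : ContDiff ℝ (⊤ : ℕ∞) f) (hf0 : f 0 = 0)
    -- ν is a (not necessarily unit) normal vector of the frontal f
    (hν : ContDiff ℝ (⊤ : ℕ∞) ν)
    (hν0 : ∀ᶠ q in 𝓝 (0 : ℝ × ℝ × ℝ), ν q ≠ 0)
    (hnormal : ∀ᶠ q in 𝓝 (0 : ℝ × ℝ × ℝ),
      ∀ v : ℝ × ℝ × ℝ, dot4 (fderiv ℝ f q v) (ν q) = 0)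
    -- lam is an identifier of singularities
    (hlam : ContDiff ℝ (⊤ : ℕ∞) lam)
    (hident : ∃ c : ℝ × ℝ × ℝ → ℝ, ContDiff ℝ (⊤ : ℕ∞) c ∧
      (∀ᶠ q in 𝓝 (0 : ℝ × ℝ × ℝ), c q ≠ 0) ∧
      ∀ᶠ q in 𝓝 (0 : ℝ × ℝ × ℝ), lam q =
        c q * det4 (fderiv ℝ f q (1,0,0)) (fderiv ℝ f q (0,1,0))
          (fderiv ℝ f q (0,0,1)) (ν q))
    -- rank df₀ = 2 and η is a null vector field
    (hrank : Module.finrank ℝ ↥(LinearMap.range (fderiv ℝ f 0).toLinearMap) = 2)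
    (hη : ContDiff ℝ (⊤ : ℕ∞) η)
    (hnull : ∀ᶠ q in 𝓝 (0 : ℝ × ℝ × ℝ), lam q = 0 →
      LinearMap.ker (fderiv ℝ f q).toLinearMap = Submodule.span ℝ {η q})
    -- non-degeneracy: ηlam(0) ≠ 0
    (hηlam : fderiv ℝ lam 0 (η 0) ≠ 0)
    -- (ξ₁, ξ₂, η) is an adapted triple: ξ₁, ξ₂ linearly independent, tangent to S(f)
    (hξ₁ : ContDiff ℝ (⊤ : ℕ∞) ξ₁) (hξ₂ : ContDiff ℝ (⊤ : ℕ∞) ξ₂)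
    (hind : ∀ᶠ q in 𝓝 (0 : ℝ × ℝ × ℝ), LinearIndependent ℝ ![ξ₁ q, ξ₂ q])
    (htan₁ : ∀ᶠ q in 𝓝 (0 : ℝ × ℝ × ℝ), lam q = 0 → fderiv ℝ lam q (ξ₁ q) = 0)
    (htan₂ : ∀ᶠ q in 𝓝 (0 : ℝ × ℝ × ℝ), lam q = 0 → fderiv ℝ lam q (ξ₂ q) = 0)
    -- the function ψ̄ = det(ξ₁f, ξ₂f, ν, ην)
    (hψb : ψb = fun q => det4 (fderiv ℝ f q (ξ₁ q)) (fderiv ℝ f q (ξ₂ q))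
      (ν q) (fderiv ℝ ν q (η q))) :
    AEquivAt f 0 (fun q => ![q.1, q.2.1, q.2.2^2, q.2.1 * q.2.2^3]) ↔
      (ψb 0 = 0 ∧ (fderiv ℝ ψb 0 (ξ₁ 0), fderiv ℝ ψb 0 (ξ₂ 0)) ≠ (0, 0)) := by
  have hlam0 := (lam_zero f ν lam hident hrank).2
  have hind0 := hind.self_of_nhds
  have ht1 := htan₁.self_of_nhds hlam0
  have ht2 := htan₂.self_of_nhds hlam0
  have hψs : ContDiff ℝ (⊤ : ℕ∞) ψb := by
    rw [hψb]
    exact det4_contDiff ((hf.fderiv_right (by simp)).clm_apply hξ₁)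
      ((hf.fderiv_right (by simp)).clm_apply hξ₂) hν ((hν.fderiv_right (by simp)).clm_apply hη)
  have main : ∀ b : ℝ × ℝ × ℝ → ℝ, ContDiff ℝ (⊤ : ℕ∞) b → AEquivAt f 0 (gmod b) →
      ((ψb 0 = 0 ∧ (fderiv ℝ ψb 0 (ξ₁ 0), fderiv ℝ ψb 0 (ξ₂ 0)) ≠ (0, 0)) ↔
        (b 0 = 0 ∧ (fderiv ℝ b 0 (1,0,0) ≠ 0 ∨ fderiv ℝ b 0 (0,1,0) ≠ 0))) := by
    intro b hb hA
    obtain ⟨φ, Φ, hφ, hΦ, hφ0, -, he⟩ := hA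
    rw [hf0] at hΦ
    obtain ⟨ρ, V, hρ, hV, hρ0, hV0, hc, hk⟩ := inv_key f ν lam ξ₁ ξ₂ η hf hf0 hν hν0 hnormal hlam
      hident hlam0 hη hnull hηlam hξ₁ hξ₂ hind0 ht1 ht2 b hb φ Φ hφ hΦ hφ0 he
    refine inv_final lam ψb ρ V b φ (ξ₁ 0) (ξ₂ 0) (η 0) (hlam.of_le (by simp)).contDiffAt
      (hψs.of_le (by simp)).contDiffAt hρ hV (hb.of_le (by simp)).contDiffAt (hφ.1.of_le (by simp))
      hρ0 hV0 hlam0 hφ0 hηlam ht1 ht2 hc ?_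
    rw [hψb]
    exact hk
  constructor
  · intro h
    have hs : (fun q : ℝ × ℝ × ℝ => (![q.1, q.2.1, q.2.2^2, q.2.1 * q.2.2^3] : E4)) =
        gmod (fun q => q.2.1) := by
      funext q
      simp only [gmod, mul_comm]
    rw [hs] at h
    have hb : ContDiff ℝ (⊤ : ℕ∞) (fun q : ℝ × ℝ × ℝ => q.2.1) := by fun_prop
    refine (main _ hb h).2 ⟨rfl, Or.inr ?_⟩
    have hd : HasFDerivAt (fun q : ℝ × ℝ × ℝ => q.2.1)
        ((ContinuousLinearMap.fst ℝ ℝ ℝ).comp (ContinuousLinearMap.snd ℝ ℝ (ℝ × ℝ))) 0 :=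
      ((ContinuousLinearMap.fst ℝ ℝ ℝ).comp (ContinuousLinearMap.snd ℝ ℝ (ℝ × ℝ))).hasFDerivAt
    rw [hd.fderiv]
    simp
  · intro h
    obtain ⟨b, hb, hA⟩ := normal_form_A1 f ν lam ξ₁ ξ₂ η hf hf0 hν hlam hident hrank hη hnull
      hηlam hind0 ht1 ht2
    obtain ⟨h0, h1⟩ := (main b hb hA).1 h
    exact hA.trans' (gmod_std b hb h0 h1)
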